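/- Under the action of the Mathieu group M_{24} on 24 points, there are exactly two orbits of 12-element subsets containing no nonzero codeword of the binary Golay code (the 'transverse' and 'penumbral' dodecads), of sizes 2^6·3^2·7·11·23 and 2^8·3^2·7·23 respectively. -/

import Mathlib

open Module

/-- A binary Golay code: a `[24,12,8]` binary linear code (such a code is unique up
to coordinate permutation). -/
def IsGolayCode (C : Submodule (ZMod 2) (Fin 24 → ZMod 2)) : Prop :=
  Module.finrank (ZMod 2) C = 12 ∧
  ∀ c ∈ C, c ≠ 0 → 8 ≤ (Finset.univ.filter fun i => c i ≠ 0).card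

/-- Membership in the Mathieu group `M₂₄`, the automorphism group of the Golay
code `C`. -/
def InM24 (C : Submodule (ZMod 2) (Fin 24 → ZMod 2)) (g : Equiv.Perm (Fin 24)) : Prop :=
  ∀ c ∈ C, (fun i => c (g i)) ∈ C

/-- A 12-element subset of the 24 points containing (the support of) no nonzero
Golay codeword. -/
def IsFreeDodecad (C : Submodule (ZMod 2) (Fin 24 → ZMod 2)) (S : Finset (Fin 24)) :
    Prop :=
  S.card = 12 ∧ ¬ ∃ c ∈ C, c ≠ 0 ∧ ∀ i, c i ≠ 0 → i ∈ S

/-- Two subsets lie in the same `M₂₄`-orbit. -/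
def M24Equiv (C : Submodule (ZMod 2) (Fin 24 → ZMod 2)) (S S' : Finset (Fin 24)) :
    Prop :=
  ∃ g : Equiv.Perm (Fin 24), InM24 C g ∧ S.image g = S'


/-! ### A small verified clique search on bit masks -/

namespace GolayAux

/-- Number of ones among the lowest twelve bits. -/
def pc (x : ℕ) : ℕ :=
  x % 2 + (x / 2) % 2 + (x / 4) % 2 + (x / 8) % 2 + (x / 16) % 2 + (x / 32) % 2 +
  (x / 64) % 2 + (x / 128) % 2 + (x / 256) % 2 + (x / 512) % 2 + (x / 1024) % 2 + (x / 2048) % 2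

/-- Branch on each candidate being in the family or not. -/
def srch (cpt : ℕ → ℕ → Bool) (ok : List ℕ → Bool) (n : ℕ) :
    ℕ → List ℕ → List ℕ → Bool
  | 0, _, _ => false
  | f + 1, cs, ch =>
    match cs with
    | [] => Nat.blt ch.length n || ok ch
    | x :: xs =>
      Nat.blt (ch.length + (xs.length + 1)) n ||
        (srch cpt ok n f (xs.filter (cpt x)) (x :: ch) && srch cpt ok n f xs ch)

theorem card_le_of_cover (F : Finset ℕ) (ch cs : List ℕ) (h : ∀ x ∈ F, x ∈ ch ∨ x ∈ cs) :
    F.card ≤ ch.length + cs.length := by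
  have : F ⊆ (ch ++ cs).toFinset := by
    intro x hx
    simpa using h x hx
  calc F.card ≤ (ch ++ cs).toFinset.card := Finset.card_le_card this
    _ ≤ (ch ++ cs).length := List.toFinset_card_le _
    _ = _ := by simp

theorem srch_sound (cpt : ℕ → ℕ → Bool) (ok : List ℕ → Bool) (n : ℕ) (F : Finset ℕ)
    (hn : n ≤ F.card) (hc : ∀ x ∈ F, ∀ y ∈ F, x ≠ y → cpt x y = true) :
    ∀ (f : ℕ) (cs ch : List ℕ), srch cpt ok n f cs ch = true →
      (∀ x ∈ F, x ∈ ch ∨ x ∈ cs) → ∃ l, ok l = true ∧ ∀ x ∈ F, x ∈ l := by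
  intro f
  induction f with
  | zero => intro cs ch h; simp [srch] at h
  | succ f ih =>
    intro cs ch h hcov
    have hle := card_le_of_cover F ch cs hcov
    cases cs with
    | nil =>
      simp only [srch, Bool.or_eq_true] at h
      rcases h with h | h
      · rw [Nat.blt_eq] at h
        simp at hle; omega
      · exact ⟨ch, h, fun x hx => by simpa using hcov x hx⟩
    | cons x xs =>
      simp only [srch, Bool.or_eq_true, Bool.and_eq_true] at h
      rcases h with h | ⟨h1, h2⟩
      · rw [Nat.blt_eq] at h
        simp at hle; omega
      · by_cases hx : x ∈ F
        · refine ih _ _ h1 ?_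
          intro y hy
          by_cases hxy : x = y
          · left; simp [hxy]
          · rcases hcov y hy with h | h
            · left; simp [h]
            · right
              rw [List.mem_filter]
              refine ⟨?_, hc x hx y hy hxy⟩
              rcases List.mem_cons.1 h with h | h
              · exact absurd h.symm hxy
              · exact h
        · refine ih _ _ h2 ?_
          intro y hy
          rcases hcov y hy with h | h
          · left; exact h
          · right
            rcases List.mem_cons.1 h with h | h
            · exact absurd (h ▸ hy) hx
            · exact h

/-- The mask `x` read through the list `p` of positions. -/
def app (p : List ℕ) (x : ℕ) : ℕ :=
  p.foldr (fun q acc => 2 * acc + (x / 2 ^ q) % 2) 0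

def pairs (a b : ℕ) : List (List ℕ) := [[a, b], [b, a]]

def triples (a b c : ℕ) : List (List ℕ) :=
  [[a, b, c], [a, c, b], [b, a, c], [b, c, a], [c, a, b], [c, b, a]]

def prods (l m : List (List ℕ)) : List (List ℕ) := l.flatMap fun a => m.map fun b => a ++ b

def perms1 : List (List ℕ) :=
  prods (pairs 0 1) (prods (triples 2 3 4) (prods (triples 5 6 7) (prods (triples 8 9 10) [[11]])))

def perms2 : List (List ℕ) :=
  prods (pairs 0 1) (prods (triples 2 3 4) (prods (pairs 5 6) (prods (triples 7 8 9) [[10, 11]])))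

def T1 : List ℕ := [2048, 31, 227, 364, 692, 849, 906, 1240, 1330, 1413, 1577, 1606]

def T2 : List ℕ := [31, 992, 1123, 1196, 1364, 1681, 1802, 2245, 2342, 2456, 2601, 2642]

def okk (perms : List (List ℕ)) (T : List ℕ) (l : List ℕ) : Bool :=
  perms.any fun p => l.all fun x => T.any fun t => Nat.beq t (app p x)

def cpt1 (x y : ℕ) : Bool :=
  Nat.beq x 2048 || (Nat.beq y 2048 || Nat.beq (pc (x &&& y)) 2)

def cpt2 (x y : ℕ) : Bool :=
  Nat.beq (pc (x &&& y)) 2 || Nat.beq (pc (x &&& y)) 0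

def cand1 : List ℕ :=
  (List.range 2048).filter fun m =>
    Nat.beq (pc m) 5 && (Nat.beq (pc (31 &&& m)) 2 && Nat.beq (pc (227 &&& m)) 2)

def cand2 : List ℕ :=
  (List.range 4096).filter fun m =>
    Nat.beq (pc m) 5 && (cpt2 31 m && (cpt2 992 m && cpt2 1123 m))

set_option maxRecDepth 100000 in
theorem run1 : srch cpt1 (okk perms1 T1) 12 200 cand1 [2048, 31, 227] = true := by
  decide +kernel

set_option maxRecDepth 100000 in
theorem run2 : srch cpt2 (okk perms2 T2) 12 200 cand2 [31, 992, 1123] = true := by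
  decide +kernel

end GolayAux

/-! ### Classification of the 12 by 12 matrices -/

namespace GolayAux

theorem pc_eq (x : ℕ) : pc x = ∑ i : Fin 12, (x.testBit i).toNat := by
  simp only [Fin.sum_univ_succ, Nat.toNat_testBit]
  simp [pc]
  omega

theorem app_testBit (p : List ℕ) (x j : ℕ) (h : j < p.length) :
    (app p x).testBit j = x.testBit (p.getD j 0) := by
  induction p generalizing j with
  | nil => simp at h
  | cons q p ih =>
    have e : app (q :: p) x = 2 * app p x + (x / 2 ^ q) % 2 := rfl
    rw [e]
    cases j with
    | zero =>
      simp only [List.getD_cons_zero, Nat.testBit_eq_decide_div_mod_eq]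
      congr 1
      rw [eq_iff_iff]
      omega
    | succ j =>
      have h' : j < p.length := by simpa using h
      rw [Nat.testBit_succ, List.getD_cons_succ, ← ih j h']
      congr 1
      omega

def wt (f : Fin 12 → Bool) : ℕ := (Finset.univ.filter fun j => f j = true).card

def ix (f g : Fin 12 → Bool) : ℕ := (Finset.univ.filter fun j => f j = true ∧ g j = true).card

theorem pc_ofBits (f : Fin 12 → Bool) : pc (Nat.ofBits f) = wt f := by
  rw [pc_eq, wt, Finset.card_filter]
  refine Finset.sum_congr rfl fun i _ => ?_
  rw [Nat.testBit_ofBits_lt _ _ i.2]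
  cases f i <;> simp

theorem pc_and (f g : Fin 12 → Bool) : pc (Nat.ofBits f &&& Nat.ofBits g) = ix f g := by
  rw [pc_eq, ix, Finset.card_filter]
  refine Finset.sum_congr rfl fun i _ => ?_
  rw [Nat.testBit_and, Nat.testBit_ofBits_lt _ _ i.2, Nat.testBit_ofBits_lt _ _ i.2]
  cases f i <;> cases g i <;> simp

theorem ofBits_inj (f g : Fin 12 → Bool) (h : Nat.ofBits f = Nat.ofBits g) : f = g := by
  funext i
  have := congrArg (fun x => Nat.testBit x i) h
  simpa [Nat.testBit_ofBits_lt] using this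

/-- The conditions on the (complemented) redundancy matrix. -/
structure Half (B : Fin 12 → Fin 12 → Bool) : Prop where
  w : ∀ i, wt (B i) = 5 ∨ wt (B i) = 1
  d : ∀ i k, i ≠ k → wt (B i) + wt (B k) = 2 * ix (B i) (B k) + 6 ∨
    wt (B i) + wt (B k) = 2 * ix (B i) (B k) + 10

theorem ix_self (f : Fin 12 → Bool) : ix f f = wt f := by simp [ix, wt]

theorem ix_comm (f g : Fin 12 → Bool) : ix f g = ix g f := by simp [ix, and_comm]

theorem ix_le (f g : Fin 12 → Bool) : ix f g ≤ wt f :=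
  Finset.card_le_card (by intro j; simp +contextual)

/-- Double counting. -/
theorem sum_ix (B : Fin 12 → Fin 12 → Bool) (i : Fin 12) :
    ∑ k, ix (B i) (B k) = ∑ j, if B i j = true then wt (fun k => B k j) else 0 := by
  simp only [ix, wt, Finset.card_filter]
  rw [Finset.sum_comm]
  refine Finset.sum_congr rfl fun j _ => ?_
  cases B i j <;> simp

theorem sum_wt (B : Fin 12 → Fin 12 → Bool) :
    ∑ k, wt (B k) = ∑ j, wt (fun k => B k j) := by
  simp only [wt, Finset.card_filter]
  rw [Finset.sum_comm]

/-- Matching of labellings with equal fibre sizes. -/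
theorem exists_perm_of_card {X : Type} [DecidableEq X] (u v : Fin 12 → X)
    (h : ∀ x, (Finset.univ.filter fun j => u j = x).card =
      (Finset.univ.filter fun j => v j = x).card) :
    ∃ τ : Equiv.Perm (Fin 12), ∀ j, u (τ j) = v j := by
  have e : ∀ x, Nonempty ({j // v j = x} ≃ {j // u j = x}) := by
    intro x
    refine ⟨Fintype.equivOfCardEq ?_⟩
    rw [Fintype.card_subtype, Fintype.card_subtype, h]
  refine ⟨Equiv.ofFiberEquiv (fun x => (e x).some), fun j => ?_⟩
  exact Equiv.ofFiberEquiv_map _ _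

theorem card_pred {X : Type} [DecidableEq X] [Fintype X] (u : Fin 12 → X) (P : X → Bool) :
    (Finset.univ.filter fun j => P (u j) = true).card =
      ∑ x, if P x = true then (Finset.univ.filter fun j => u j = x).card else 0 := by
  simp only [Finset.card_filter]
  simp_rw [← Finset.sum_filter, Finset.sum_comm' (s := Finset.univ.filter fun x => P x = true)
    (t := fun x => Finset.univ.filter fun j => u j = x)
    (t' := Finset.univ.filter fun j => P (u j) = true)
    (s' := fun j => {u j}) (h := by intro x y; simp; constructor <;> (rintro ⟨a, b⟩; simp_all))]
  simp

/-- Number of labels equal to a given one. -/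
def cnt (u : Fin 12 → Bool × Bool × Bool) (x : Bool × Bool × Bool) : ℕ :=
  (Finset.univ.filter fun j => u j = x).card

theorem cnt_key (a b c : Fin 12 → Bool) (n : Bool × Bool × Bool → ℕ)
    (hn : n = cnt fun j => (a j, b j, c j)) :
    12 = ∑ x, n x ∧ wt a = (∑ x, if x.1 = true then n x else 0) ∧
    wt b = (∑ x, if x.2.1 = true then n x else 0) ∧
    wt c = (∑ x, if x.2.2 = true then n x else 0) ∧
    ix a b = (∑ x, if (x.1 && x.2.1) = true then n x else 0) ∧
    ix a c = (∑ x, if (x.1 && x.2.2) = true then n x else 0) ∧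
    ix b c = (∑ x, if (x.2.1 && x.2.2) = true then n x else 0) := by
  subst hn
  refine ⟨?_, ?_, ?_, ?_, ?_, ?_, ?_⟩
  · simpa [cnt] using card_pred (fun j => (a j, b j, c j)) (fun _ => true)
  · exact card_pred (fun j => (a j, b j, c j)) (fun x => x.1)
  · exact card_pred (fun j => (a j, b j, c j)) (fun x => x.2.1)
  · exact card_pred (fun j => (a j, b j, c j)) (fun x => x.2.2)
  · refine Eq.trans ?_ (card_pred (fun j => (a j, b j, c j)) (fun x => x.1 && x.2.1))
    simp [ix]
  · refine Eq.trans ?_ (card_pred (fun j => (a j, b j, c j)) (fun x => x.1 && x.2.2))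
    simp [ix]
  · refine Eq.trans ?_ (card_pred (fun j => (a j, b j, c j)) (fun x => x.2.1 && x.2.2))
    simp [ix]

theorem three_perm (a b c a' b' c' : Fin 12 → Bool) (h1 : wt a = wt a') (h2 : wt b = wt b')
    (h3 : wt c = wt c') (h4 : ix a b = ix a' b') (h5 : ix a c = ix a' c') (h6 : ix b c = ix b' c')
    (h7 : ix a b = 0) :
    ∃ τ : Equiv.Perm (Fin 12), ∀ j, a (τ j) = a' j ∧ b (τ j) = b' j ∧ c (τ j) = c' j := by
  obtain ⟨τ, hτ⟩ := exists_perm_of_card (fun j => (a j, b j, c j)) (fun j => (a' j, b' j, c' j)) (by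
    have k1 := cnt_key a b c _ rfl
    have k2 := cnt_key a' b' c' _ rfl
    change ∀ x, cnt (fun j => (a j, b j, c j)) x = cnt (fun j => (a' j, b' j, c' j)) x
    generalize cnt (fun j => (a j, b j, c j)) = n at *
    generalize cnt (fun j => (a' j, b' j, c' j)) = n' at *
    simp [Fintype.sum_prod_type] at k1 k2
    rintro ⟨x, y, z⟩
    cases x <;> cases y <;> cases z <;> omega)
  exact ⟨τ, fun j => by simpa using hτ j⟩

theorem okk_spec (perms : List (List ℕ)) (T l : List ℕ) (h : okk perms T l = true) :
    ∃ p ∈ perms, ∀ x ∈ l, app p x ∈ T := by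
  simp only [okk, List.any_eq_true, List.all_eq_true, Nat.beq_eq] at h
  obtain ⟨p, hp, h⟩ := h
  refine ⟨p, hp, fun x hx => ?_⟩
  obtain ⟨t, ht, e⟩ := h x hx
  exact e ▸ ht

def validP (p : List ℕ) : Bool :=
  Nat.beq p.length 12 && (p.all (fun x => Nat.blt x 12) &&
    (List.range 12).all (fun a => (List.range 12).all fun b =>
      Nat.beq a b || !(Nat.beq (p.getD a 0) (p.getD b 0))))

theorem valid1 : perms1.all validP = true := by decide +kernel

theorem valid2 : perms2.all validP = true := by decide +kernel

theorem perm_of_valid (p : List ℕ) (h : validP p = true) :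
    p.length = 12 ∧ ∃ τ : Equiv.Perm (Fin 12), ∀ j : Fin 12, ((τ j : Fin 12) : ℕ) = p.getD j 0 := by
  simp only [validP, Bool.and_eq_true, Nat.beq_eq, List.all_eq_true, Nat.blt_eq, List.mem_range,
    Bool.or_eq_true, Bool.not_eq_true'] at h
  obtain ⟨h1, h2, h3⟩ := h
  refine ⟨h1, ?_⟩
  have hlt : ∀ j : Fin 12, p.getD j 0 < 12 := by
    intro j
    have hj : (j : ℕ) < p.length := by rw [h1]; exact j.2
    rw [List.getD_eq_getElem _ _ hj]
    exact h2 _ (List.getElem_mem hj)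
  let f : Fin 12 → Fin 12 := fun j => ⟨p.getD j 0, hlt j⟩
  have hf : Function.Injective f := by
    intro i j hij
    have e : p.getD i 0 = p.getD j 0 := congrArg Fin.val hij
    rcases h3 i i.2 j j.2 with h | h
    · exact Fin.ext h
    · rw [e] at h
      have h' := Nat.beq_refl (p.getD j 0)
      rw [h] at h'
      cases h'
  exact ⟨Equiv.ofBijective f (Finite.injective_iff_bijective.1 hf), fun j => rfl⟩

/-- From masks in the table to a pair of permutations. -/
theorem finish (B : Fin 12 → Fin 12 → Bool) (hB : Function.Injective B) (T : List ℕ)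
    (hT : T.length = 12) (p : List ℕ) (hp : validP p = true)
    (h : ∀ i, app p (Nat.ofBits (B i)) ∈ T) :
    ∃ σ τ : Equiv.Perm (Fin 12), ∀ k j, B (σ k) (τ j) = (T.getD k 0).testBit j := by
  obtain ⟨hl, τ, hτ⟩ := perm_of_valid p hp
  have h' : ∀ i, ∃ k : Fin 12, ∀ j, B i (τ j) = (T.getD k 0).testBit j := by
    intro i
    obtain ⟨k, hk, e⟩ := List.mem_iff_getElem.1 (h i)
    refine ⟨⟨k, hT ▸ hk⟩, fun j => ?_⟩
    rw [List.getD_eq_getElem _ _ hk, e, app_testBit _ _ _ (by rw [hl]; exact j.2), ← hτ,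
      Nat.testBit_ofBits_lt _ _ (τ j).2]
  choose s hs using h'
  have hinj : Function.Injective s := by
    intro a b hab
    apply hB
    funext j
    have h1 := hs a (τ.symm j)
    have h2 := hs b (τ.symm j)
    rw [hab, ← h2] at h1
    simpa using h1
  let σ := Equiv.ofBijective s (Finite.injective_iff_bijective.1 hinj)
  refine ⟨σ.symm, τ, fun k j => ?_⟩
  rw [hs]
  have : s (σ.symm k) = k := σ.apply_symm_apply k
  rw [this]

theorem ofBits_of_testBit (f : Fin 12 → Bool) (x : ℕ) (hx : x < 4096)
    (h : ∀ j : Fin 12, f j = x.testBit j) : Nat.ofBits f = x := by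
  have : f = fun j : Fin 12 => x.testBit j := funext h
  rw [this, Nat.ofBits_testBit, Nat.mod_eq_of_lt hx]

theorem wt_perm (f : Fin 12 → Bool) (τ : Equiv.Perm (Fin 12)) : wt (fun j => f (τ j)) = wt f := by
  simp only [wt, Finset.card_filter]
  exact Equiv.sum_comp τ (fun j => if f j = true then 1 else 0)

theorem ix_perm (f g : Fin 12 → Bool) (τ : Equiv.Perm (Fin 12)) :
    ix (fun j => f (τ j)) (fun j => g (τ j)) = ix f g := by
  simp only [ix, Finset.card_filter]
  exact Equiv.sum_comp τ (fun j => if f j = true ∧ g j = true then 1 else 0)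

theorem Half.inj {B : Fin 12 → Fin 12 → Bool} (h : Half B) : Function.Injective B := by
  intro i k e
  by_contra hne
  have := h.d i k hne
  rw [e, ix_self] at this
  omega

theorem sum_rest (B : Fin 12 → Fin 12 → Bool) (i : Fin 12) (h5 : wt (B i) = 5)
    (hc : ∀ j, B i j = true → wt (fun k => B k j) = 5) :
    ∑ k ∈ Finset.univ.erase i, ix (B i) (B k) = 20 := by
  have h1 : ∑ k, ix (B i) (B k) = 25 := by
    rw [sum_ix]
    have : ∀ j ∈ (Finset.univ : Finset (Fin 12)),
        (if B i j = true then wt (fun k => B k j) else 0) = if B i j = true then 5 else 0 := by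
      intro j _
      split_ifs with h
      · exact hc j h
      · rfl
    rw [Finset.sum_congr rfl this, ← Finset.sum_filter, Finset.sum_const]
    have : (Finset.univ.filter fun j => B i j = true).card = 5 := h5
    rw [this]; rfl
  have h2 := Finset.add_sum_erase Finset.univ (fun k => ix (B i) (B k)) (Finset.mem_univ i)
  simp only [ix_self] at h2
  omega

theorem class2 (B : Fin 12 → Fin 12 → Bool) (hr : Half B) (hc : Half fun j i => B i j)
    (h5 : ∀ i, wt (B i) = 5) :
    ∃ σ τ : Equiv.Perm (Fin 12), ∀ k j, B (σ k) (τ j) = (T2.getD k 0).testBit j := by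
  have hcw : ∀ j, wt (fun k => B k j) = 5 := by
    have hs := sum_wt B
    simp only [h5] at hs
    have hle : ∀ j ∈ (Finset.univ : Finset (Fin 12)), wt (fun k => B k j) ≤ 5 := by
      intro j _
      rcases hc.w j with h | h <;> simp only [h] <;> omega
    have := (Finset.sum_eq_sum_iff_of_le hle).1 (by rw [← hs])
    exact fun j => this j (Finset.mem_univ j)
  have hix : ∀ i k, i ≠ k → ix (B i) (B k) = 2 ∨ ix (B i) (B k) = 0 := by
    intro i k hik
    have := hr.d i k hik
    rw [h5, h5] at this
    omega
  obtain ⟨i1, hne, h01⟩ : ∃ i, (0 : Fin 12) ≠ i ∧ ix (B 0) (B i) = 0 := by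
    by_contra! hcon
    have hs := sum_rest B 0 (h5 0) (fun j _ => hcw j)
    have : ∀ k ∈ Finset.univ.erase (0 : Fin 12), ix (B 0) (B k) = 2 := by
      intro k hk
      have hk' : (0 : Fin 12) ≠ k := (Finset.ne_of_mem_erase hk).symm
      rcases hix 0 k hk' with h | h
      · exact h
      · exact absurd h (hcon k hk')
    rw [Finset.sum_congr rfl this] at hs
    simp at hs
  -- a row meeting both of these in two points
  obtain ⟨i2, hn2, hn2', h02, h12⟩ : ∃ i, (0 : Fin 12) ≠ i ∧ i1 ≠ i ∧ ix (B 0) (B i) = 2 ∧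
      ix (B i1) (B i) = 2 := by
    have hs0 := sum_rest B 0 (h5 0) (fun j _ => hcw j)
    have hs1 := sum_rest B i1 (h5 i1) (fun j _ => hcw j)
    have e0 := Finset.add_sum_erase (Finset.univ.erase (0 : Fin 12)) (fun k => ix (B 0) (B k))
      (Finset.mem_erase.2 ⟨hne.symm, Finset.mem_univ i1⟩)
    have e1 := Finset.add_sum_erase (Finset.univ.erase i1) (fun k => ix (B i1) (B k))
      (Finset.mem_erase.2 ⟨hne, Finset.mem_univ 0⟩)
    rw [Finset.erase_right_comm] at e1
    have h10 : ix (B i1) (B 0) = 0 := by rw [ix_comm]; exact h01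
    simp only [h01, h10, hs0, hs1, zero_add] at e0 e1
    have hcard : ((Finset.univ.erase (0 : Fin 12)).erase i1).card = 10 := by
      rw [Finset.card_erase_of_mem (Finset.mem_erase.2 ⟨hne.symm, Finset.mem_univ i1⟩),
        Finset.card_erase_of_mem (Finset.mem_univ _)]
      simp
    by_contra! hcon
    have hle : ∀ k ∈ (Finset.univ.erase (0 : Fin 12)).erase i1,
        ix (B 0) (B k) + ix (B i1) (B k) ≤ 2 := by
      intro k hk
      have hk1 : i1 ≠ k := (Finset.ne_of_mem_erase hk).symm
      have hk0 : (0 : Fin 12) ≠ k := (Finset.ne_of_mem_erase (Finset.mem_of_mem_erase hk)).symm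
      have a := hix 0 k hk0
      have b := hix i1 k hk1
      have c := hcon k hk0 hk1
      omega
    have := Finset.sum_le_sum hle
    rw [Finset.sum_add_distrib, e0, e1, Finset.sum_const, hcard] at this
    simp at this
  obtain ⟨ρ, hρ⟩ := three_perm (B 0) (B i1) (B i2) (fun j => Nat.testBit 31 j)
    (fun j => Nat.testBit 992 j) (fun j => Nat.testBit 1123 j)
    (by rw [h5]; decide +kernel) (by rw [h5]; decide +kernel) (by rw [h5]; decide +kernel)
    (by rw [h01]; decide +kernel) (by rw [h02]; decide +kernel) (by rw [h12]; decide +kernel) h01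
  set D : Fin 12 → Fin 12 → Bool := fun i j => B i (ρ j) with hD
  have hDinj : Function.Injective D := by
    intro a b hab
    apply hr.inj
    funext j
    simpa [hD] using congrFun hab (ρ.symm j)
  have m0 : Nat.ofBits (D 0) = 31 := ofBits_of_testBit _ _ (by norm_num) fun j => (hρ j).1
  have m1 : Nat.ofBits (D i1) = 992 := ofBits_of_testBit _ _ (by norm_num) fun j => (hρ j).2.1
  have m2 : Nat.ofBits (D i2) = 1123 := ofBits_of_testBit _ _ (by norm_num) fun j => (hρ j).2.2
  have hminj : Function.Injective fun i => Nat.ofBits (D i) :=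
    fun a b hab => hDinj (ofBits_inj _ _ hab)
  have hcp : ∀ i k, i ≠ k → cpt2 (Nat.ofBits (D i)) (Nat.ofBits (D k)) = true := by
    intro i k hik
    simp only [cpt2, pc_and, Bool.or_eq_true, Nat.beq_eq]
    rw [hD, ix_perm (B i) (B k) ρ]
    exact hix i k hik
  obtain ⟨l, hl, hl'⟩ := srch_sound cpt2 (okk perms2 T2) 12
    (Finset.univ.image fun i => Nat.ofBits (D i))
    (by rw [Finset.card_image_of_injective _ hminj]; simp)
    (by
      intro x hx y hy hxy
      obtain ⟨i, -, rfl⟩ := Finset.mem_image.1 hx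
      obtain ⟨k, -, rfl⟩ := Finset.mem_image.1 hy
      exact hcp i k (fun h => hxy (by rw [h])))
    200 cand2 [31, 992, 1123] run2
    (by
      intro x hx
      obtain ⟨i, -, rfl⟩ := Finset.mem_image.1 hx
      by_cases g0 : i = 0
      · left; subst g0; simp [m0]
      by_cases g1 : i = i1
      · left; subst g1; simp [m1]
      by_cases g2 : i = i2
      · left; subst g2; simp [m2]
      right
      rw [cand2, List.mem_filter, List.mem_range]
      refine ⟨Nat.ofBits_lt_two_pow _, ?_⟩
      have c0 := hcp 0 i (Ne.symm g0)
      have c1 := hcp i1 i (Ne.symm g1)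
      have c2 := hcp i2 i (Ne.symm g2)
      rw [m0] at c0
      rw [m1] at c1
      rw [m2] at c2
      have w5 : pc (Nat.ofBits (D i)) = 5 := by
        rw [pc_ofBits, hD, wt_perm (B i) ρ, h5]
      rw [c0, c1, c2, w5]
      rfl)
  obtain ⟨p, hp, hpT⟩ := okk_spec _ _ _ hl
  obtain ⟨σ, τ, h⟩ := finish D hDinj T2 rfl p (List.all_eq_true.1 valid2 p hp)
    (fun i => hpT _ (hl' _ (Finset.mem_image_of_mem _ (Finset.mem_univ i))))
  exact ⟨σ, τ.trans ρ, h⟩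

theorem class1 (B : Fin 12 → Fin 12 → Bool) (hr : Half B) (hc : Half fun j i => B i j)
    (i0 : Fin 12) (h1 : wt (B i0) = 1) :
    ∃ σ τ : Equiv.Perm (Fin 12), ∀ k j, B (σ k) (τ j) = (T1.getD k 0).testBit j := by
  have h5 : ∀ i, i0 ≠ i → wt (B i) = 5 ∧ ix (B i0) (B i) = 0 := by
    intro i hi
    have := hr.d i0 i hi
    have := hr.w i
    omega
  obtain ⟨z, hz⟩ := Finset.card_eq_one.1 h1
  have hz' : ∀ j, B i0 j = true ↔ j = z := by
    intro j
    have := congrArg (fun s => j ∈ s) hz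
    simpa using this
  have hz0 : ∀ i, i0 ≠ i → B i z = false := by
    intro i hi
    have h0 := (h5 i hi).2
    rw [ix, Finset.card_eq_zero, Finset.filter_eq_empty_iff] at h0
    have := h0 (Finset.mem_univ z)
    simpa [(hz' z).2 rfl] using this
  have hcz : wt (fun k => B k z) = 1 := by
    rw [wt, Finset.card_eq_one]
    refine ⟨i0, ?_⟩
    ext i
    simp only [Finset.mem_filter, Finset.mem_univ, true_and, Finset.mem_singleton]
    constructor
    · intro h
      by_contra hne
      rw [hz0 i (Ne.symm hne)] at h
      cases h
    · rintro rfl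
      exact (hz' z).2 rfl
  have hcw : ∀ j, j ≠ z → wt (fun k => B k j) = 5 := by
    intro j hj
    have a := hc.d j z hj
    have b := hc.w j
    simp only [hcz] at a
    omega
  have hix : ∀ i k, i0 ≠ i → i0 ≠ k → i ≠ k → ix (B i) (B k) = 2 := by
    intro i k hi hk hik
    have hle : ∀ i k, i0 ≠ i → i0 ≠ k → i ≠ k → ix (B i) (B k) ≤ 2 := by
      intro i k hi hk hik
      have := hr.d i k hik
      rw [(h5 i hi).1, (h5 k hk).1] at this
      omega
    have hs := sum_rest B i (h5 i hi).1 (fun j hj => hcw j (by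
      rintro rfl
      rw [hz0 i hi] at hj
      cases hj))
    have e0 := Finset.add_sum_erase (Finset.univ.erase i) (fun k => ix (B i) (B k))
      (Finset.mem_erase.2 ⟨hi, Finset.mem_univ i0⟩)
    have h00 : ix (B i) (B i0) = 0 := by rw [ix_comm]; exact (h5 i hi).2
    simp only [h00, hs, zero_add] at e0
    have hcard : ((Finset.univ.erase i).erase i0).card = 10 := by
      rw [Finset.card_erase_of_mem (Finset.mem_erase.2 ⟨hi, Finset.mem_univ i0⟩),
        Finset.card_erase_of_mem (Finset.mem_univ _)]
      simp
    have hle' : ∀ k ∈ (Finset.univ.erase i).erase i0, ix (B i) (B k) ≤ 2 := by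
      intro k hk
      exact hle i k hi (Finset.ne_of_mem_erase hk).symm
        (Finset.ne_of_mem_erase (Finset.mem_of_mem_erase hk)).symm
    have := (Finset.sum_eq_sum_iff_of_le hle').1 (by
      rw [e0, Finset.sum_const, hcard]; rfl)
    exact this k (Finset.mem_erase.2 ⟨hk.symm, Finset.mem_erase.2 ⟨hik.symm, Finset.mem_univ _⟩⟩)
  obtain ⟨i1, i2, hn1, hn2, hn12⟩ : ∃ i1 i2 : Fin 12, i0 ≠ i1 ∧ i0 ≠ i2 ∧ i1 ≠ i2 := by
    have : ∀ a : Fin 12, ∃ i1 i2 : Fin 12, a ≠ i1 ∧ a ≠ i2 ∧ i1 ≠ i2 := by decide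
    exact this i0
  obtain ⟨ρ, hρ⟩ := three_perm (B i0) (B i1) (B i2) (fun j => Nat.testBit 2048 j)
    (fun j => Nat.testBit 31 j) (fun j => Nat.testBit 227 j)
    (by rw [h1]; decide +kernel) (by rw [(h5 _ hn1).1]; decide +kernel)
    (by rw [(h5 _ hn2).1]; decide +kernel)
    (by rw [(h5 _ hn1).2]; decide +kernel) (by rw [(h5 _ hn2).2]; decide +kernel)
    (by rw [hix _ _ hn1 hn2 hn12]; decide +kernel) (h5 _ hn1).2
  set D : Fin 12 → Fin 12 → Bool := fun i j => B i (ρ j) with hD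
  have hDinj : Function.Injective D := by
    intro a b hab
    apply hr.inj
    funext j
    simpa [hD] using congrFun hab (ρ.symm j)
  have m0 : Nat.ofBits (D i0) = 2048 := ofBits_of_testBit _ _ (by norm_num) fun j => (hρ j).1
  have m1 : Nat.ofBits (D i1) = 31 := ofBits_of_testBit _ _ (by norm_num) fun j => (hρ j).2.1
  have m2 : Nat.ofBits (D i2) = 227 := ofBits_of_testBit _ _ (by norm_num) fun j => (hρ j).2.2
  have hminj : Function.Injective fun i => Nat.ofBits (D i) :=
    fun a b hab => hDinj (ofBits_inj _ _ hab)
  have hcp : ∀ i k, i0 ≠ i → i0 ≠ k → i ≠ k →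
      pc (Nat.ofBits (D i) &&& Nat.ofBits (D k)) = 2 := by
    intro i k hi hk hik
    rw [pc_and, hD, ix_perm (B i) (B k) ρ]
    exact hix i k hi hk hik
  have hlt : ∀ i, i0 ≠ i → Nat.ofBits (D i) < 2048 := by
    intro i hi
    have hb : (Nat.ofBits (D i)).testBit 11 = false := by
      have e : D i0 11 = true := (hρ 11).1
      have e2 : ρ 11 = z := (hz' _).1 e
      rw [Nat.testBit_ofBits_lt _ _ (by norm_num)]
      change B i (ρ 11) = false
      rw [e2]
      exact hz0 i hi
    have hl : Nat.ofBits (D i) < 4096 := Nat.ofBits_lt_two_pow _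
    rw [Nat.testBit_eq_decide_div_mod_eq] at hb
    simp only [decide_eq_false_iff_not] at hb
    omega
  obtain ⟨l, hl, hl'⟩ := srch_sound cpt1 (okk perms1 T1) 12
    (Finset.univ.image fun i => Nat.ofBits (D i))
    (by rw [Finset.card_image_of_injective _ hminj]; simp)
    (by
      intro x hx y hy hxy
      obtain ⟨i, -, rfl⟩ := Finset.mem_image.1 hx
      obtain ⟨k, -, rfl⟩ := Finset.mem_image.1 hy
      simp only [cpt1, Bool.or_eq_true, Nat.beq_eq]
      by_cases gi : i0 = i
      · left; rw [← gi]; exact m0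
      by_cases gk : i0 = k
      · right; left; rw [← gk]; exact m0
      right; right
      exact hcp i k gi gk (fun h => hxy (by rw [h])))
    200 cand1 [2048, 31, 227] run1
    (by
      intro x hx
      obtain ⟨i, -, rfl⟩ := Finset.mem_image.1 hx
      by_cases g0 : i0 = i
      · left; subst g0; simp [m0]
      by_cases g1 : i1 = i
      · left; subst g1; simp [m1]
      by_cases g2 : i2 = i
      · left; subst g2; simp [m2]
      right
      rw [cand1, List.mem_filter, List.mem_range]
      refine ⟨hlt i g0, ?_⟩
      have c1 := hcp i1 i hn1 g0 g1
      have c2 := hcp i2 i hn2 g0 g2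
      rw [m1] at c1
      rw [m2] at c2
      have w5 : pc (Nat.ofBits (D i)) = 5 := by
        rw [pc_ofBits, hD, wt_perm (B i) ρ, (h5 i g0).1]
      rw [c1, c2, w5]
      rfl)
  obtain ⟨p, hp, hpT⟩ := okk_spec _ _ _ hl
  obtain ⟨σ, τ, h⟩ := finish D hDinj T1 rfl p (List.all_eq_true.1 valid1 p hp)
    (fun i => hpT _ (hl' _ (Finset.mem_image_of_mem _ (Finset.mem_univ i))))
  exact ⟨σ, τ.trans ρ, h⟩

end GolayAux

/-! ### Golay codes as families of sets -/

namespace GolayAux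

open scoped symmDiff Classical

/-- The indicator vector of a set. -/
def ind (s : Finset (Fin 24)) : Fin 24 → ZMod 2 := fun i => if i ∈ s then 1 else 0

/-- The family of supports of codewords. -/
noncomputable def K (C : Submodule (ZMod 2) (Fin 24 → ZMod 2)) : Finset (Finset (Fin 24)) :=
  Finset.univ.filter fun s => ind s ∈ C

variable {C : Submodule (ZMod 2) (Fin 24 → ZMod 2)}

theorem mem_K {s : Finset (Fin 24)} : s ∈ K C ↔ ind s ∈ C := by simp [K]

theorem ind_ne_zero (s : Finset (Fin 24)) (i : Fin 24) : ind s i ≠ 0 ↔ i ∈ s := by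
  unfold ind; split_ifs with h <;> simp [h]

theorem ind_symmDiff (s t : Finset (Fin 24)) : ind (s ∆ t) = ind s + ind t := by
  funext i
  simp only [ind, Pi.add_apply, Finset.mem_symmDiff]
  by_cases h1 : i ∈ s <;> by_cases h2 : i ∈ t <;> simp [h1, h2]
  decide

theorem zmod2 (x : ZMod 2) : x = 0 ∨ x = 1 := by revert x; decide

theorem ind_filter (c : Fin 24 → ZMod 2) : ind (Finset.univ.filter fun i => c i ≠ 0) = c := by
  funext i
  rcases zmod2 (c i) with h | h <;> simp [ind, h]

theorem ind_eq_zero (s : Finset (Fin 24)) : ind s = 0 ↔ s = ∅ := by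
  constructor
  · intro h
    ext i
    have := ind_ne_zero s i
    rw [h] at this
    simpa using this
  · rintro rfl
    funext i
    simp [ind]

theorem ind_inj {s t : Finset (Fin 24)} (h : ind s = ind t) : s = t := by
  ext i
  rw [← ind_ne_zero, h, ind_ne_zero]

theorem empty_mem : ∅ ∈ K C := by
  rw [mem_K, (ind_eq_zero ∅).2 rfl]
  exact C.zero_mem

theorem add_mem {s t : Finset (Fin 24)} (hs : s ∈ K C) (ht : t ∈ K C) : s ∆ t ∈ K C := by
  rw [mem_K, ind_symmDiff]
  exact C.add_mem (mem_K.1 hs) (mem_K.1 ht)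

theorem min_K (hC : IsGolayCode C) {s : Finset (Fin 24)} (hs : s ∈ K C) (h0 : s ≠ ∅) :
    8 ≤ s.card := by
  have := hC.2 (ind s) (mem_K.1 hs) (fun h => h0 ((ind_eq_zero s).1 h))
  simpa only [ind_ne_zero, Finset.filter_univ_mem] using this

theorem card_symm (s t : Finset (Fin 24)) :
    (s ∆ t).card + 2 * (s ∩ t).card = s.card + t.card := by
  have e : s ∆ t = (s \ t) ∪ (t \ s) := rfl
  have hd : Disjoint (s \ t) (t \ s) := by
    rw [Finset.disjoint_left]; simp +contextual
  have h1 := Finset.card_sdiff_add_card_inter s t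
  have h2 := Finset.card_sdiff_add_card_inter t s
  rw [Finset.inter_comm t s] at h2
  rw [e, Finset.card_union_of_disjoint hd]
  omega

theorem eq_of_symm_card (hC : IsGolayCode C) {s t : Finset (Fin 24)} (h : s ∆ t ∈ K C)
    (hlt : (s ∆ t).card < 8) : s = t := by
  by_contra hne
  have := min_K hC h (by rwa [← Finset.bot_eq_empty, ne_eq, symmDiff_eq_bot])
  omega

theorem symm_nonzero (hC : IsGolayCode C) {s t : Finset (Fin 24)} (hs : s ∈ K C) (ht : t ∈ K C)
    (hne : s ≠ t) : 8 ≤ (s ∆ t).card :=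
  min_K hC (add_mem hs ht) (by rwa [← Finset.bot_eq_empty, ne_eq, symmDiff_eq_bot])

theorem card_K (hC : IsGolayCode C) : (K C).card = 4096 := by
  have h1 : Nat.card C = 2 ^ 12 := by
    rw [Module.natCard_eq_pow_finrank (K := ZMod 2), hC.1]; simp
  have e : (K C) ≃ C :=
    { toFun := fun s => ⟨ind s.1, mem_K.1 s.2⟩
      invFun := fun c => ⟨Finset.univ.filter fun i => c.1 i ≠ 0, by rw [mem_K, ind_filter]; exact c.2⟩
      left_inv := fun s => Subtype.ext (ind_inj (ind_filter _))
      right_inv := fun c => Subtype.ext (ind_filter _) }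
  have h2 := Nat.card_congr e
  rw [h1] at h2
  simpa using h2

/-- Octads through a set. -/
noncomputable def oct (C : Submodule (ZMod 2) (Fin 24 → ZMod 2)) (T : Finset (Fin 24)) :
    Finset (Finset (Fin 24)) :=
  (K C).filter fun s => s.card = 8 ∧ T ⊆ s

theorem mem_oct {T O : Finset (Fin 24)} : O ∈ oct C T ↔ O ∈ K C ∧ O.card = 8 ∧ T ⊆ O := by
  simp [oct]

abbrev W (k : ℕ) : Finset (Finset (Fin 24)) := Finset.powersetCard k Finset.univ

theorem card_small : (Finset.univ.filter fun s : Finset (Fin 24) => s.card ≤ 3).card = 2325 := by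
  rw [Finset.card_eq_sum_card_fiberwise (f := Finset.card) (t := Finset.range 4)]
  · have : ∀ k ∈ Finset.range 4, ((Finset.univ.filter fun s : Finset (Fin 24) => s.card ≤ 3).filter
        fun s => s.card = k).card = Nat.choose 24 k := by
      intro k hk
      have hk' := Finset.mem_range.1 hk
      rw [show Nat.choose 24 k = (W k).card by rw [Finset.card_powersetCard]; simp]
      congr 1
      ext s
      simp only [Finset.mem_filter, Finset.mem_univ, true_and, Finset.mem_powersetCard,
        Finset.subset_univ]
      omega
    rw [Finset.sum_congr rfl this]
    decide
  · intro s hs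
    simp at hs ⊢
    omega

/-- The sextet of a 4-set has exactly six members. -/
theorem fiber_six (hC : IsGolayCode C) (T : Finset (Fin 24)) (hT : T.card = 4) :
    ((W 4).filter fun s => s ∆ T ∈ K C).card = 6 := by
  let Q := (Fin 24 → ZMod 2) ⧸ C
  have : Finite Q := inferInstance
  have : Fintype Q := Fintype.ofFinite Q
  have hQ : Fintype.card Q = 4096 := by
    have h1 : Nat.card Q = 2 ^ (Module.finrank (ZMod 2) Q) := by
      rw [Module.natCard_eq_pow_finrank (K := ZMod 2)]; simp
    have h2 := Submodule.finrank_quotient_add_finrank C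
    rw [hC.1] at h2
    simp at h2
    rw [Nat.card_eq_fintype_card] at h1
    have h3 : Module.finrank (ZMod 2) Q = 12 := by change Module.finrank (ZMod 2) (_ ⧸ C) = 12; omega
    rw [h1, h3]; norm_num
  let φ : Finset (Fin 24) → Q := fun s => Submodule.Quotient.mk (ind s)
  have hφ : ∀ s t, φ s = φ t ↔ s ∆ t ∈ K C := by
    intro s t
    rw [mem_K, ind_symmDiff]
    change (Submodule.Quotient.mk (ind s) : Q) = Submodule.Quotient.mk (ind t) ↔ _
    rw [Submodule.Quotient.eq]
    have : ind s - ind t = ind s + ind t := by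
      funext i
      simp only [Pi.sub_apply, Pi.add_apply]
      rcases zmod2 (ind s i) with h | h <;> rcases zmod2 (ind t i) with h' | h' <;>
        rw [h, h'] <;> decide
    rw [this]
  have hle : ∀ s t, s.card + t.card < 8 → φ s = φ t → s = t := by
    intro s t hst h
    refine eq_of_symm_card hC ((hφ s t).1 h) ?_
    have := card_symm s t
    omega
  let L := (Finset.univ.filter fun s : Finset (Fin 24) => s.card ≤ 3).image φ
  have hL : L.card = 2325 := by
    rw [Finset.card_image_of_injOn, card_small]
    intro s hs t ht h
    simp at hs ht
    exact hle s t (by omega) h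
  have hR : Lᶜ.card = 1771 := by
    rw [Finset.card_compl, hL, hQ]
  have hmaps : ∀ s ∈ W 4, φ s ∈ Lᶜ := by
    intro s hs
    rw [Finset.mem_compl, Finset.mem_image]
    rintro ⟨t, ht, h⟩
    have hs' := (Finset.mem_powersetCard.1 hs).2
    simp at ht
    have := hle t s (by omega) h
    subst this
    omega
  have hsum := Finset.card_eq_sum_card_fiberwise (f := φ) (s := W 4) (t := Lᶜ) hmaps
  have hcard : (W 4).card = 10626 := by
    rw [Finset.card_powersetCard]; simp; decide
  have hfib : ∀ q ∈ Lᶜ, ((W 4).filter fun s => φ s = q).card ≤ 6 := by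
    intro q _
    have h1 : (((W 4).filter fun s => φ s = q).biUnion id).card =
        ∑ s ∈ (W 4).filter fun s => φ s = q, (id s : Finset (Fin 24)).card := by
      apply Finset.card_biUnion
      intro s hs t ht hne
      simp only [Finset.mem_coe, Finset.mem_filter, Finset.mem_powersetCard] at hs ht
      have h8 : 8 ≤ (s ∆ t).card := by
        by_contra hlt
        exact hne (eq_of_symm_card hC ((hφ s t).1 (hs.2.trans ht.2.symm)) (by omega))
      have := card_symm s t
      have h0 : (s ∩ t).card = 0 := by omega
      exact Finset.disjoint_iff_inter_eq_empty.2 (Finset.card_eq_zero.1 h0)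
    rw [Finset.sum_congr rfl (g := fun _ => 4) (by
      intro s hs
      simp only [Finset.mem_filter, Finset.mem_powersetCard] at hs
      exact hs.1.2), Finset.sum_const] at h1
    have h2 := Finset.card_le_univ (((W 4).filter fun s => φ s = q).biUnion id)
    simp only [Fintype.card_fin, smul_eq_mul] at h1 h2
    omega
  have heq := (Finset.sum_eq_sum_iff_of_le hfib).1 (by
    rw [← hsum, hcard, Finset.sum_const, hR]; rfl)
  have hTW : T ∈ W 4 := Finset.mem_powersetCard.2 ⟨Finset.subset_univ _, hT⟩
  rw [← heq (φ T) (hmaps T hTW)]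
  simp only [hφ]

theorem card_oct (hC : IsGolayCode C) (T : Finset (Fin 24)) (hT : T.card = 4) :
    (oct C T).card = 5 := by
  have h6 := fiber_six hC T hT
  have hTW : T ∈ (W 4).filter fun s => s ∆ T ∈ K C := by
    simp [Finset.mem_powersetCard, hT, empty_mem]
  have h5 := Finset.card_erase_of_mem hTW
  rw [h6] at h5
  rw [show (5 : ℕ) = 6 - 1 from rfl, ← h5]
  symm
  refine Finset.card_bij (fun s _ => s ∆ T) ?_ ?_ ?_
  · intro s hs
    simp only [Finset.mem_erase, Finset.mem_filter, Finset.mem_powersetCard] at hs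
    obtain ⟨hne, ⟨-, h4⟩, hK⟩ := hs
    have h8 := min_K hC hK (by rwa [← Finset.bot_eq_empty, ne_eq, symmDiff_eq_bot])
    have hc := card_symm s T
    have h0 : (s ∩ T).card = 0 := by omega
    have hd := Finset.disjoint_iff_inter_eq_empty.2 (Finset.card_eq_zero.1 h0)
    refine mem_oct.2 ⟨hK, by omega, ?_⟩
    intro i hi
    rw [Finset.mem_symmDiff]
    exact Or.inr ⟨hi, fun h => (Finset.disjoint_left.1 hd) h hi⟩
  · intro a _ b _ h
    exact symmDiff_left_injective T h
  · intro O hO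
    obtain ⟨hK, h8, hsub⟩ := mem_oct.1 hO
    refine ⟨O ∆ T, ?_, symmDiff_symmDiff_cancel_right T O⟩
    have hc := card_symm O T
    rw [Finset.inter_eq_right.2 hsub] at hc
    simp only [Finset.mem_erase, Finset.mem_filter, Finset.mem_powersetCard,
      symmDiff_symmDiff_cancel_right]
    refine ⟨?_, ⟨Finset.subset_univ _, by omega⟩, hK⟩
    intro h
    rw [symmDiff_eq_right] at h
    rw [h] at h8
    simp at h8

theorem oct_inter (hC : IsGolayCode C) {O O' : Finset (Fin 24)} (h : O ∈ K C) (h' : O' ∈ K C)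
    (h8 : O.card = 8) (h8' : O'.card = 8) (hne : O ≠ O') : (O ∩ O').card ≤ 4 := by
  have := card_symm O O'
  have := symm_nonzero hC h h' hne
  omega

theorem oct_inter_eq (hC : IsGolayCode C) {T O O' : Finset (Fin 24)} (hT : T.card = 4)
    (h : O ∈ oct C T) (h' : O' ∈ oct C T) (hne : O ≠ O') : O ∩ O' = T := by
  obtain ⟨a, b, c⟩ := mem_oct.1 h
  obtain ⟨a', b', c'⟩ := mem_oct.1 h'
  have := oct_inter hC a a' b b' hne
  exact (Finset.eq_of_subset_of_card_le (Finset.subset_inter c c') (by omega)).symm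

/-- Through a 4-set and a further point there is exactly one octad. -/
theorem oct_point (hC : IsGolayCode C) {T : Finset (Fin 24)} (hT : T.card = 4) (i : Fin 24)
    (hi : i ∉ T) : ((oct C T).filter fun O => i ∈ O).card = 1 := by
  have hle : ∀ i ∈ Tᶜ, ((oct C T).filter fun O => i ∈ O).card ≤ 1 := by
    intro i hi
    rw [Finset.card_le_one]
    intro O hO O' hO'
    rw [Finset.mem_filter] at hO hO'
    by_contra hne
    have e := oct_inter_eq hC hT hO.1 hO'.1 hne
    rw [Finset.mem_compl, ← e, Finset.mem_inter] at hi
    exact hi ⟨hO.2, hO'.2⟩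
  have hs : ∑ i ∈ Tᶜ, ((oct C T).filter fun O => i ∈ O).card = 20 := by
    simp only [Finset.card_filter]
    rw [Finset.sum_comm]
    have : ∀ O ∈ oct C T, (∑ i ∈ Tᶜ, if i ∈ O then 1 else 0) = 4 := by
      intro O hO
      obtain ⟨a, b, c⟩ := mem_oct.1 hO
      rw [← Finset.card_filter]
      have e : Tᶜ.filter (fun i => i ∈ O) = O \ T := by
        ext i; simp [and_comm]
      rw [e, Finset.card_sdiff_of_subset c]
      omega
    rw [Finset.sum_congr rfl this, Finset.sum_const, card_oct hC T hT]
    rfl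
  have hc : Tᶜ.card = 20 := by rw [Finset.card_compl, hT]; rfl
  have := (Finset.sum_eq_sum_iff_of_le hle).1 (by rw [hs, Finset.sum_const, hc]; rfl)
  exact this i (Finset.mem_compl.2 hi)

theorem univ_mem (hC : IsGolayCode C) : Finset.univ ∈ K C := by
  obtain ⟨T, -, hT⟩ := Finset.exists_subset_card_eq (s := (Finset.univ : Finset (Fin 24))) (n := 4)
    (by simp)
  have : ind Finset.univ = ∑ O ∈ oct C T, ind O := by
    funext i
    rw [Finset.sum_apply]
    simp only [ind, Finset.mem_univ, if_true]
    rw [Finset.sum_boole]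
    by_cases hi : i ∈ T
    · have : (oct C T).filter (fun O => i ∈ O) = oct C T := by
        rw [Finset.filter_eq_self]
        intro O hO
        exact (mem_oct.1 hO).2.2 hi
      rw [this, card_oct hC T hT]
      decide
    · rw [oct_point hC hT i hi]; simp
  rw [mem_K, this]
  exact C.sum_mem fun O hO => mem_K.1 (mem_oct.1 hO).1

theorem compl_mem (hC : IsGolayCode C) {s : Finset (Fin 24)} (hs : s ∈ K C) : sᶜ ∈ K C := by
  have := add_mem hs (univ_mem hC)
  rwa [← Finset.top_eq_univ, symmDiff_top] at this

theorem weight_low (hC : IsGolayCode C) {c : Finset (Fin 24)} (hc : c ∈ K C) (h9 : 9 ≤ c.card) :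
    12 ≤ c.card := by
  by_contra hlt
  obtain ⟨T, hTc, hT⟩ := Finset.exists_subset_card_eq (s := c) (n := 4) (by omega)
  have hk : ∀ O ∈ oct C T, ((c \ T).filter fun i => i ∈ O).card ≤ (c.card - 8) / 2 := by
    intro O hO
    obtain ⟨a, b, d⟩ := mem_oct.1 hO
    have h1 := card_symm c O
    have h2 := symm_nonzero hC hc a (by rintro rfl; omega)
    have e : (c \ T).filter (fun i => i ∈ O) = (c ∩ O) \ T := by
      ext i; simp; tauto
    rw [e, Finset.card_sdiff_of_subset (Finset.subset_inter hTc d)]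
    omega
  have hs : ∑ O ∈ oct C T, ((c \ T).filter fun i => i ∈ O).card = (c \ T).card := by
    simp only [Finset.card_filter]
    rw [Finset.sum_comm, Finset.card_eq_sum_ones]
    refine Finset.sum_congr rfl fun i hi => ?_
    rw [← Finset.card_filter]
    exact oct_point hC hT i (Finset.mem_sdiff.1 hi).2
  have h3 := Finset.sum_le_sum hk
  rw [hs, Finset.sum_const, card_oct hC T hT, Finset.card_sdiff_of_subset hTc] at h3
  simp at h3
  omega

theorem weights (hC : IsGolayCode C) {c : Finset (Fin 24)} (hc : c ∈ K C) :
    c.card = 0 ∨ c.card = 8 ∨ c.card = 12 ∨ c.card = 16 ∨ c.card = 24 := by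
  have h1 := weight_low hC hc
  have h2 := weight_low hC (compl_mem hC hc)
  have h3 := min_K hC hc
  have h4 := min_K hC (compl_mem hC hc)
  have h5 : c.card + cᶜ.card = 24 := by rw [Finset.card_add_card_compl]; rfl
  rw [ne_eq, ← Finset.card_eq_zero] at h3 h4
  omega

theorem even_inter (hC : IsGolayCode C) {c d : Finset (Fin 24)} (hc : c ∈ K C) (hd : d ∈ K C) :
    (c ∩ d).card % 2 = 0 := by
  have h1 := weights hC hc
  have h2 := weights hC hd
  have h3 := weights hC (add_mem hc hd)
  have h4 := card_symm c d
  omega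

end GolayAux

/-! ### Counting -/

namespace GolayAux

open scoped symmDiff Classical

variable {C : Submodule (ZMod 2) (Fin 24 → ZMod 2)}

/-- Codewords of a given weight. -/
noncomputable def wd (C : Submodule (ZMod 2) (Fin 24 → ZMod 2)) (k : ℕ) :
    Finset (Finset (Fin 24)) := (K C).filter fun s => s.card = k

theorem mem_wd {k : ℕ} {s : Finset (Fin 24)} : s ∈ wd C k ↔ s ∈ K C ∧ s.card = k := by
  simp [wd]

theorem mem_W {k : ℕ} {s : Finset (Fin 24)} : s ∈ W k ↔ s.card = k := by
  simp [Finset.mem_powersetCard]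

theorem card_W (k : ℕ) : (W k).card = Nat.choose 24 k := by
  rw [Finset.card_powersetCard]; simp

/-- Double counting of incidences. -/
theorem double_count {α β : Type} (s : Finset α) (t : Finset β) (R : α → β → Prop)
    [∀ a b, Decidable (R a b)] :
    ∑ a ∈ s, (t.filter fun b => R a b).card = ∑ b ∈ t, (s.filter fun a => R a b).card := by
  simp only [Finset.card_filter]
  exact Finset.sum_comm

theorem card_wd8 (hC : IsGolayCode C) : (wd C 8).card = 759 := by
  have h := double_count (W 4) (wd C 8) (fun T O => T ⊆ O)
  rw [Finset.sum_congr rfl (g := fun _ => 5), Finset.sum_congr (s₁ := wd C 8) rfl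
    (g := fun _ => 70), Finset.sum_const, Finset.sum_const, card_W] at h
  · have e : Nat.choose 24 4 = 10626 := by decide
    rw [e] at h
    simp only [smul_eq_mul] at h
    omega
  · intro O hO
    have e : (W 4).filter (fun T => T ⊆ O) = Finset.powersetCard 4 O := by
      ext T; simp [Finset.mem_powersetCard, and_comm]
    rw [e, Finset.card_powersetCard, (mem_wd.1 hO).2]
    decide
  · intro T hT
    rw [← card_oct hC T (mem_W.1 hT)]
    refine congrArg Finset.card ?_
    ext O
    simp [mem_wd, mem_oct, and_assoc]

theorem card_wd16 (hC : IsGolayCode C) : (wd C 16).card = 759 := by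
  rw [← card_wd8 hC]
  refine Finset.card_bij (fun s _ => sᶜ) ?_ ?_ ?_
  · intro s hs
    obtain ⟨h1, h2⟩ := mem_wd.1 hs
    exact mem_wd.2 ⟨compl_mem hC h1, by rw [Finset.card_compl, h2]; rfl⟩
  · intro a _ b _ h
    exact compl_injective h
  · intro s hs
    obtain ⟨h1, h2⟩ := mem_wd.1 hs
    exact ⟨sᶜ, mem_wd.2 ⟨compl_mem hC h1, by rw [Finset.card_compl, h2]; rfl⟩, compl_compl s⟩

theorem card_wd12 (hC : IsGolayCode C) : (wd C 12).card = 2576 := by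
  have h := Finset.card_eq_sum_card_fiberwise (f := Finset.card) (s := K C)
    (t := ({0, 8, 12, 16, 24} : Finset ℕ)) (by
      intro s hs
      have := weights hC (Finset.mem_coe.1 hs)
      simpa using this)
  rw [card_K hC] at h
  have h0 : (wd C 0).card = 1 := by
    rw [Finset.card_eq_one]
    refine ⟨∅, ?_⟩
    ext s
    simp only [mem_wd, Finset.card_eq_zero, Finset.mem_singleton]
    exact ⟨fun h => h.2, fun h => ⟨h ▸ empty_mem, h⟩⟩
  have h24 : (wd C 24).card = 1 := by
    rw [Finset.card_eq_one]
    refine ⟨Finset.univ, ?_⟩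
    ext s
    simp only [mem_wd, Finset.mem_singleton]
    constructor
    · intro h
      rw [← Finset.card_eq_iff_eq_univ, h.2]; rfl
    · rintro rfl
      exact ⟨univ_mem hC, by simp⟩
  have e : ∀ k, ((K C).filter fun s => s.card = k) = wd C k := fun k => rfl
  simp only [e] at h
  rw [Finset.sum_insert (by decide), Finset.sum_insert (by decide), Finset.sum_insert (by decide),
    Finset.sum_insert (by decide), Finset.sum_singleton, h0, h24, card_wd8 hC, card_wd16 hC] at h
  omega

theorem card_meet4 (hC : IsGolayCode C) {O : Finset (Fin 24)} (hO : O ∈ wd C 8) :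
    ((wd C 8).filter fun P => (O ∩ P).card = 4).card = 280 := by
  obtain ⟨hK, h8⟩ := mem_wd.1 hO
  have h := double_count (Finset.powersetCard 4 O) ((wd C 8).erase O) (fun T P => T ⊆ P)
  rw [Finset.sum_congr rfl (g := fun _ => 4), Finset.sum_const, Finset.card_powersetCard, h8] at h
  · rw [Finset.card_filter, ← Finset.sum_erase (wd C 8) (a := O)
      (f := fun P => if (O ∩ P).card = 4 then 1 else 0) (by simp [h8]), ← show Nat.choose 8 4 • 4 = 280 by decide, h]
    · refine Finset.sum_congr rfl fun P hP => ?_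
      obtain ⟨hne, hP⟩ := Finset.mem_erase.1 hP
      obtain ⟨hK', h8'⟩ := mem_wd.1 hP
      have hle := oct_inter hC hK hK' h8 h8' hne.symm
      have e : (Finset.powersetCard 4 O).filter (fun T => T ⊆ P) =
          Finset.powersetCard 4 (O ∩ P) := by
        ext T
        simp only [Finset.mem_filter, Finset.mem_powersetCard, Finset.subset_inter_iff]
        tauto
      rw [e, Finset.card_powersetCard]
      split_ifs with h4
      · rw [h4]; rfl
      · rw [Nat.choose_eq_zero_of_lt (by omega)]
  · intro T hT
    obtain ⟨hTO, hT4⟩ := Finset.mem_powersetCard.1 hT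
    have e : ((wd C 8).erase O).filter (fun P => T ⊆ P) = (oct C T).erase O := by
      ext P
      simp only [Finset.mem_filter, Finset.mem_erase, mem_wd, mem_oct]
      tauto
    rw [e, Finset.card_erase_of_mem (mem_oct.2 ⟨hK, h8, hTO⟩), card_oct hC T hT4]

theorem card_super (P : Finset (Fin 24)) (k : ℕ) (hP : P.card + k = 12) :
    ((W 12).filter fun S => P ⊆ S).card = Nat.choose (12 + k) k := by
  have e : Nat.choose (12 + k) k = (Finset.powersetCard k Pᶜ).card := by
    rw [Finset.card_powersetCard, Finset.card_compl]
    simp only [Fintype.card_fin]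
    congr 1
    omega
  rw [e]
  refine Finset.card_bij (fun S _ => S \ P) ?_ ?_ ?_
  · intro S hS
    obtain ⟨h1, h2⟩ := Finset.mem_filter.1 hS
    rw [mem_W] at h1
    rw [Finset.mem_powersetCard, Finset.card_sdiff_of_subset h2]
    refine ⟨?_, by omega⟩
    intro i hi
    simp at hi ⊢
    exact hi.2
  · intro S hS S' hS' h
    have h2 := (Finset.mem_filter.1 hS).2
    have h2' := (Finset.mem_filter.1 hS').2
    rw [← Finset.sdiff_union_of_subset h2, h, Finset.sdiff_union_of_subset h2']
  · intro T hT
    obtain ⟨h1, h2⟩ := Finset.mem_powersetCard.1 hT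
    have hd : Disjoint T P := by
      rw [Finset.disjoint_left]
      intro i hi
      simpa using h1 hi
    refine ⟨T ∪ P, ?_, ?_⟩
    · rw [Finset.mem_filter, mem_W, Finset.card_union_of_disjoint hd]
      exact ⟨by omega, Finset.subset_union_right⟩
    · exact Finset.union_sdiff_cancel_right hd

/-- Octads inside a set. -/
noncomputable def inn (C : Submodule (ZMod 2) (Fin 24 → ZMod 2)) (S : Finset (Fin 24)) :
    Finset (Finset (Fin 24)) := (wd C 8).filter fun O => O ⊆ S

theorem sum_inn (hC : IsGolayCode C) : ∑ S ∈ W 12, (inn C S).card = 1381380 := by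
  have h := double_count (W 12) (wd C 8) (fun S O => O ⊆ S)
  rw [Finset.sum_congr (s₁ := wd C 8) rfl (g := fun _ => 1820), Finset.sum_const, card_wd8 hC] at h
  · exact h
  · intro O hO
    rw [card_super O 4 (by rw [(mem_wd.1 hO).2])]
    decide

theorem sum_inn2 (hC : IsGolayCode C) : ∑ S ∈ W 12, (inn C S).offDiag.card = 212520 := by
  have h := double_count (W 12) (wd C 8).offDiag (fun S P => P.1 ∪ P.2 ⊆ S)
  have e1 : ∀ S ∈ W 12, ((wd C 8).offDiag.filter fun P => P.1 ∪ P.2 ⊆ S).card =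
      (inn C S).offDiag.card := by
    intro S _
    refine congrArg Finset.card ?_
    ext ⟨a, b⟩
    simp only [Finset.mem_filter, Finset.mem_offDiag, inn, Finset.union_subset_iff]
    clear * -
    tauto
  rw [Finset.sum_congr rfl e1] at h
  rw [h]
  have e2 : ∀ P ∈ (wd C 8).offDiag, ((W 12).filter fun S => P.1 ∪ P.2 ⊆ S).card =
      if (P.1 ∩ P.2).card = 4 then 1 else 0 := by
    rintro ⟨a, b⟩ hP
    obtain ⟨ha, hb, hne⟩ := Finset.mem_offDiag.1 hP
    obtain ⟨ha, ha8⟩ := mem_wd.1 ha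
    obtain ⟨hb, hb8⟩ := mem_wd.1 hb
    dsimp only at ha hb ha8 hb8 hne
    have hle := oct_inter hC ha hb ha8 hb8 hne
    have hu := Finset.card_union_add_card_inter a b
    dsimp only
    split_ifs with h4
    · rw [card_super (a ∪ b) 0 (by omega)]; rfl
    · rw [Finset.card_eq_zero, Finset.filter_eq_empty_iff]
      intro S hS hsub
      have := Finset.card_le_card hsub
      rw [mem_W.1 hS] at this
      omega
  have e4 : (wd C 8).offDiag = (wd C 8 ×ˢ wd C 8).filter fun P => P.1 ≠ P.2 := by
    ext P
    rw [Finset.mem_filter, Finset.mem_offDiag, Finset.mem_product, and_assoc]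
  rw [Finset.sum_congr rfl e2, e4, Finset.sum_filter, Finset.sum_product]
  have e3 : ∀ a ∈ wd C 8, (∑ b ∈ wd C 8, if a ≠ b then (if (a ∩ b).card = 4 then 1 else 0) else 0)
      = 280 := by
    intro a ha
    rw [← card_meet4 hC ha, Finset.card_filter]
    refine Finset.sum_congr rfl fun b hb => ?_
    by_cases hab : a = b
    · subst hab
      simp [(mem_wd.1 ha).2]
    · simp [hab]
  rw [Finset.sum_congr rfl e3, Finset.sum_const, card_wd8 hC]
  rfl

theorem inn_compl_disj (hC : IsGolayCode C) {S : Finset (Fin 24)} (hS : S.card = 12)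
    {a b : Finset (Fin 24)} (ha : a ∈ inn C S) (hb : b ∈ inn C S) (hne : a ≠ b) :
    (a ∩ b).card = 4 ∧ a ∪ b = S := by
  simp only [inn, Finset.mem_filter, mem_wd] at ha hb
  have hle := oct_inter hC ha.1.1 hb.1.1 ha.1.2 hb.1.2 hne
  have hu := Finset.card_union_add_card_inter a b
  have hsub := Finset.union_subset ha.2 hb.2
  have := Finset.card_le_card hsub
  refine ⟨by omega, Finset.eq_of_subset_of_card_le hsub (by omega)⟩

theorem inn_le (hC : IsGolayCode C) {S : Finset (Fin 24)} (hS : S.card = 12) :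
    (inn C S).card ≤ 3 := by
  have h1 : ((inn C S).biUnion fun O => S \ O).card = ∑ O ∈ inn C S, (S \ O).card := by
    apply Finset.card_biUnion
    intro a ha b hb hne
    obtain ⟨-, h⟩ := inn_compl_disj hC hS ha hb hne
    change Disjoint (S \ a) (S \ b)
    rw [Finset.disjoint_left]
    intro i hi hi'
    rw [Finset.mem_sdiff] at hi hi'
    have := hi.1
    rw [← h, Finset.mem_union] at this
    tauto
  rw [Finset.sum_congr rfl (g := fun _ => 4) (by
    intro O hO
    simp only [inn, Finset.mem_filter, mem_wd] at hO
    rw [Finset.card_sdiff_of_subset hO.2, hO.1.2, hS]), Finset.sum_const] at h1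
  have h2 : ((inn C S).biUnion fun O => S \ O).card ≤ S.card := by
    apply Finset.card_le_card
    rw [Finset.biUnion_subset]
    intro O _
    exact Finset.sdiff_subset
  simp only [smul_eq_mul] at h1
  omega

theorem inn_ne_two (hC : IsGolayCode C) {S : Finset (Fin 24)} (hS : S.card = 12) :
    (inn C S).card ≠ 2 := by
  intro h
  obtain ⟨a, b, hne, e⟩ := Finset.card_eq_two.1 h
  have ha : a ∈ inn C S := by rw [e]; simp
  have hb : b ∈ inn C S := by rw [e]; simp
  obtain ⟨h4, -⟩ := inn_compl_disj hC hS ha hb hne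
  have hc := card_symm a b
  have hab : a ∆ b ∈ inn C S := by
    simp only [inn, Finset.mem_filter, mem_wd] at ha hb ⊢
    refine ⟨⟨add_mem ha.1.1 hb.1.1, by omega⟩, ?_⟩
    intro i hi
    rcases Finset.mem_symmDiff.1 hi with h | h
    · exact ha.2 h.1
    · exact hb.2 h.1
  simp only [inn, Finset.mem_filter, mem_wd] at ha hb
  rw [e] at hab
  simp only [Finset.mem_insert, Finset.mem_singleton, symmDiff_eq_left, symmDiff_eq_right] at hab
  rcases hab with h | h
  · rw [h] at hb; simp at hb
  · rw [h] at ha; simp at ha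

theorem card_inn_pos (hC : IsGolayCode C) :
    ((W 12).filter fun S => (inn C S).card ≠ 0).card = 1310540 := by
  have h1 := sum_inn hC
  have h2 := sum_inn2 hC
  have h3 : ∑ S ∈ W 12, (3 * (if (inn C S).card ≠ 0 then 1 else 0) + (inn C S).offDiag.card) =
      ∑ S ∈ W 12, 3 * (inn C S).card := by
    refine Finset.sum_congr rfl fun S hS => ?_
    rw [Finset.offDiag_card]
    have a := inn_le hC (mem_W.1 hS)
    have b := inn_ne_two hC (mem_W.1 hS)
    generalize (inn C S).card = n at *
    interval_cases n <;> simp_all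
  rw [Finset.sum_add_distrib, ← Finset.mul_sum, ← Finset.mul_sum, h1, h2, ← Finset.card_filter] at h3
  omega

/-- Sets containing no nonempty codeword support. -/
def Free (C : Submodule (ZMod 2) (Fin 24 → ZMod 2)) (S : Finset (Fin 24)) : Prop :=
  S.card = 12 ∧ ∀ c ∈ K C, c ⊆ S → c = ∅

theorem free_iff (S : Finset (Fin 24)) : IsFreeDodecad C S ↔ Free C S := by
  unfold IsFreeDodecad Free
  refine and_congr_right fun _ => ?_
  constructor
  · intro h c hc hcs
    by_contra hne
    exact h ⟨ind c, mem_K.1 hc, fun h => hne ((ind_eq_zero c).1 h),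
      fun i hi => hcs ((ind_ne_zero c i).1 hi)⟩
  · rintro h ⟨c, hc, h0, hS⟩
    have := h (Finset.univ.filter fun i => c i ≠ 0) (by rw [mem_K, ind_filter]; exact hc)
      (fun i hi => hS i (by simpa using hi))
    rw [← ind_eq_zero, ind_filter] at this
    exact h0 this

theorem free_iff' (hC : IsGolayCode C) (S : Finset (Fin 24)) (hS : S.card = 12) :
    Free C S ↔ (inn C S).card = 0 ∧ S ∉ K C := by
  constructor
  · rintro ⟨-, h⟩
    constructor
    · rw [Finset.card_eq_zero, inn, Finset.filter_eq_empty_iff]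
      intro O hO hsub
      obtain ⟨h1, h2⟩ := mem_wd.1 hO
      rw [h O h1 hsub] at h2
      simp at h2
    · intro hK
      rw [h S hK le_rfl] at hS
      simp at hS
  · rintro ⟨h1, h2⟩
    refine ⟨hS, fun c hc hsub => ?_⟩
    have hle := Finset.card_le_card hsub
    rcases weights hC hc with h | h | h | h | h
    · exact Finset.card_eq_zero.1 h
    · rw [Finset.card_eq_zero, inn, Finset.filter_eq_empty_iff] at h1
      exact absurd hsub (h1 (mem_wd.2 ⟨hc, h⟩))
    · have := Finset.eq_of_subset_of_card_le hsub (by omega)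
      exact absurd (this ▸ hc) h2
    · omega
    · omega

theorem card_free (hC : IsGolayCode C) : ((W 12).filter fun S => Free C S).card = 1391040 := by
  have h : ∑ S ∈ W 12, ((if Free C S then 1 else 0) + (if (inn C S).card ≠ 0 then 1 else 0) +
      (if S ∈ K C then 1 else 0)) = ∑ S ∈ W 12, 1 := by
    refine Finset.sum_congr rfl fun S hS => ?_
    have hS' := mem_W.1 hS
    have hdis : S ∈ K C → (inn C S).card = 0 := by
      intro hK
      rw [Finset.card_eq_zero, inn, Finset.filter_eq_empty_iff]
      intro O hO hsub
      obtain ⟨h1, h2⟩ := mem_wd.1 hO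
      have hc := card_symm S O
      rw [Finset.inter_eq_right.2 hsub] at hc
      have := symm_nonzero hC hK h1 (by rintro rfl; omega)
      omega
    rw [free_iff' hC S hS']
    by_cases a : (inn C S).card = 0 <;> by_cases b : S ∈ K C <;> simp [a, b]
    exact a (hdis b)
  rw [Finset.sum_add_distrib, Finset.sum_add_distrib, ← Finset.card_filter, ← Finset.card_filter,
    ← Finset.card_filter, card_inn_pos hC, ← Finset.card_eq_sum_ones, card_W] at h
  have e : (W 12).filter (fun S => S ∈ K C) = wd C 12 := by
    ext S; rw [Finset.mem_filter, mem_W, mem_wd, and_comm]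
  have e2 : Nat.choose 24 12 = 2704156 := by decide +kernel
  rw [e, card_wd12 hC, e2] at h
  omega

/-- Penumbral sets: one swap away from an umbral dodecad. -/
def Pen (C : Submodule (ZMod 2) (Fin 24 → ZMod 2)) (S : Finset (Fin 24)) : Prop :=
  S.card = 12 ∧ ∃ D ∈ wd C 12, (D ∩ S).card = 11

theorem card_near (D : Finset (Fin 24)) (hD : D.card = 12) :
    ((W 12).filter fun S => (D ∩ S).card = 11).card = 144 := by
  have e : (D ×ˢ Dᶜ).card = 144 := by
    rw [Finset.card_product, Finset.card_compl, hD]; rfl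
  rw [← e]
  symm
  have hin : ∀ x ∈ D, ∀ y, y ∉ D → D ∩ insert y (D.erase x) = D.erase x := by
    intro x hx y hy
    ext i
    simp only [Finset.mem_inter, Finset.mem_insert, Finset.mem_erase]
    constructor
    · rintro ⟨h1, rfl | h⟩
      · exact absurd h1 hy
      · exact h
    · rintro ⟨h1, h2⟩
      exact ⟨h2, Or.inr ⟨h1, h2⟩⟩
  refine Finset.card_bij (fun p _ => insert p.2 (D.erase p.1)) ?_ ?_ ?_
  · rintro ⟨x, y⟩ hp
    obtain ⟨hx, hy⟩ := Finset.mem_product.1 hp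
    rw [Finset.mem_compl] at hy
    dsimp only at hx hy ⊢
    rw [Finset.mem_filter, mem_W, hin x hx y hy, Finset.card_erase_of_mem hx, hD,
      Finset.card_insert_of_notMem (fun h => hy (Finset.mem_of_mem_erase h)),
      Finset.card_erase_of_mem hx, hD]
    exact ⟨rfl, rfl⟩
  · rintro ⟨x, y⟩ hp ⟨x', y'⟩ hp' h
    obtain ⟨hx, hy⟩ := Finset.mem_product.1 hp
    obtain ⟨hx', hy'⟩ := Finset.mem_product.1 hp'
    rw [Finset.mem_compl] at hy hy'
    dsimp only at hx hy hx' hy' h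
    have h1 : D.erase x = D.erase x' := by
      rw [← hin x hx y hy, h, hin x' hx' y' hy']
    have hxx : x = x' := by
      by_contra hne
      have : x' ∈ D.erase x := Finset.mem_erase.2 ⟨Ne.symm hne, hx'⟩
      rw [h1] at this
      simp at this
    have hyy : y = y' := by
      have : y ∈ insert y' (D.erase x') := by rw [← h]; simp
      rcases Finset.mem_insert.1 this with h | h
      · exact h
      · exact absurd (Finset.mem_of_mem_erase h) hy
    rw [hxx, hyy]
  · intro S hS
    obtain ⟨h1, h2⟩ := Finset.mem_filter.1 hS
    rw [mem_W] at h1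
    have a := Finset.card_sdiff_add_card_inter D S
    have b := Finset.card_sdiff_add_card_inter S D
    rw [Finset.inter_comm S D] at b
    obtain ⟨x, hx⟩ := Finset.card_eq_one.1 (show (D \ S).card = 1 by omega)
    obtain ⟨y, hy⟩ := Finset.card_eq_one.1 (show (S \ D).card = 1 by omega)
    have hx' : ∀ i, (i ∈ D ∧ i ∉ S) ↔ i = x := fun i => by
      rw [← Finset.mem_sdiff, hx, Finset.mem_singleton]
    have hy' : ∀ i, (i ∈ S ∧ i ∉ D) ↔ i = y := fun i => by
      rw [← Finset.mem_sdiff, hy, Finset.mem_singleton]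
    refine ⟨(x, y), ?_, ?_⟩
    · rw [Finset.mem_product, Finset.mem_compl]
      exact ⟨((hx' x).2 rfl).1, ((hy' y).2 rfl).2⟩
    · ext i
      simp only [Finset.mem_insert, Finset.mem_erase, ne_eq]
      rw [← hx' i, ← hy' i]
      clear * -
      tauto

theorem card_pen (hC : IsGolayCode C) : ((W 12).filter fun S => Pen C S).card = 370944 := by
  have h := double_count (W 12) (wd C 12) (fun S D => (D ∩ S).card = 11)
  rw [Finset.sum_congr (s₁ := wd C 12) rfl (g := fun _ => 144)
    (fun D hD => card_near D (mem_wd.1 hD).2), Finset.sum_const, card_wd12 hC] at h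
  rw [Finset.card_filter]
  refine Eq.trans (Finset.sum_congr rfl fun S hS => ?_) h
  have hS' := mem_W.1 hS
  split_ifs with hp
  · obtain ⟨-, D, hD, hDS⟩ := hp
    symm
    rw [Finset.card_eq_one]
    refine ⟨D, ?_⟩
    ext E
    rw [Finset.mem_filter, Finset.mem_singleton]
    constructor
    · rintro ⟨hE, hES⟩
      obtain ⟨h1, h2⟩ := mem_wd.1 hD
      obtain ⟨h3, h4⟩ := mem_wd.1 hE
      refine eq_of_symm_card hC (add_mem h3 h1) ?_
      have hc := card_symm E D
      have hu := Finset.card_union_add_card_inter (D ∩ S) (E ∩ S)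
      have hl : ((D ∩ S) ∪ (E ∩ S)).card ≤ S.card :=
        Finset.card_le_card (Finset.union_subset Finset.inter_subset_right Finset.inter_subset_right)
      have hi : ((D ∩ S) ∩ (E ∩ S)).card ≤ (E ∩ D).card := by
        apply Finset.card_le_card
        intro i
        simp only [Finset.mem_inter]
        clear * -
        tauto
      omega
    · rintro rfl
      exact ⟨hD, hDS⟩
  · symm
    rw [Finset.card_eq_zero, Finset.filter_eq_empty_iff]
    intro D hD hDS
    exact hp ⟨hS', D, hD, hDS⟩

theorem Pen.free (hC : IsGolayCode C) {S : Finset (Fin 24)} (h : Pen C S) : Free C S := by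
  obtain ⟨hS, D, hD, hDS⟩ := h
  obtain ⟨hK, h12⟩ := mem_wd.1 hD
  refine ⟨hS, fun c hc hsub => ?_⟩
  by_contra hne
  have h8 := min_K hC hc hne
  have hcS := Finset.card_le_card hsub
  have hu := Finset.card_union_add_card_inter (D ∩ S) c
  have hl : ((D ∩ S) ∪ c).card ≤ S.card :=
    Finset.card_le_card (Finset.union_subset Finset.inter_subset_right hsub)
  have hi : ((D ∩ S) ∩ c).card ≤ (D ∩ c).card := by
    apply Finset.card_le_card
    intro i
    simp only [Finset.mem_inter]
    tauto
  have hcs := card_symm D c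
  have e : D = c := eq_of_symm_card hC (add_mem hK hc) (by omega)
  rw [← e] at hsub
  rw [Finset.inter_eq_left.2 hsub] at hDS
  omega

theorem card_trans (hC : IsGolayCode C) :
    ((W 12).filter fun S => Free C S ∧ ¬ Pen C S).card = 1020096 := by
  have h1 := card_free hC
  have h2 := card_pen hC
  have h3 := Finset.card_filter_add_card_filter_not (s := (W 12).filter fun S => Free C S)
    (fun S => Pen C S)
  rw [Finset.filter_filter, Finset.filter_filter, h1] at h3
  have e : (W 12).filter (fun S => Free C S ∧ Pen C S) = (W 12).filter fun S => Pen C S := by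
    ext S
    simp only [Finset.mem_filter]
    exact ⟨fun h => ⟨h.1, h.2.2⟩, fun h => ⟨h.1, h.2.free hC, h.2⟩⟩
  rw [e, h2] at h3
  omega

end GolayAux

/-! ### Normal forms and orbits -/

namespace GolayAux

open scoped symmDiff Classical

variable {C : Submodule (ZMod 2) (Fin 24 → ZMod 2)}

theorem row_unique {S : Finset (Fin 24)} (hS : Free C S) {r s : Finset (Fin 24)} (hr : r ∈ K C)
    (hs : s ∈ K C) (h : ∀ x, x ∉ S → (x ∈ r ↔ x ∈ s)) : r = s := by
  have h0 : r ∆ s = ∅ := by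
    refine hS.2 _ (add_mem hr hs) ?_
    intro x hx
    by_contra hxS
    have := h x hxS
    rw [Finset.mem_symmDiff] at hx
    tauto
  rwa [← Finset.bot_eq_empty, symmDiff_eq_bot] at h0

theorem exists_row (hC : IsGolayCode C) {S : Finset (Fin 24)} (hS : Free C S) {i : Fin 24}
    (hi : i ∉ S) : ∃ r ∈ K C, ∀ x, x ∉ S → (x ∈ r ↔ x = i) := by
  have hinj : Set.InjOn (fun s : Finset (Fin 24) => s \ S) (K C : Set (Finset (Fin 24))) := by
    intro r hr s hs h
    refine row_unique hS (Finset.mem_coe.1 hr) (Finset.mem_coe.1 hs) fun x hx => ?_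
    have h' : x ∈ r \ S ↔ x ∈ s \ S := by
      have : r \ S = s \ S := h
      rw [this]
    simpa [hx] using h'
  have hc := Finset.card_image_of_injOn hinj
  have hsub : (K C).image (fun s : Finset (Fin 24) => s \ S) ⊆ Sᶜ.powerset := by
    intro t ht
    obtain ⟨s, -, rfl⟩ := Finset.mem_image.1 ht
    rw [Finset.mem_powerset]
    intro x hx
    rw [Finset.mem_compl]
    exact (Finset.mem_sdiff.1 hx).2
  have heq := Finset.eq_of_subset_of_card_le hsub (by
    rw [hc, card_K hC, Finset.card_powerset, Finset.card_compl, hS.1]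
    simp)
  have hmem : ({i} : Finset (Fin 24)) ∈ Sᶜ.powerset := by
    simpa using hi
  rw [← heq] at hmem
  obtain ⟨r, hr, hri⟩ := Finset.mem_image.1 hmem
  refine ⟨r, hr, fun x hx => ?_⟩
  have h' : x ∈ r \ S ↔ x ∈ ({i} : Finset (Fin 24)) := by rw [← hri]
  simpa [hx] using h'

theorem compl_free (hC : IsGolayCode C) {S : Finset (Fin 24)} (hS : Free C S) : Free C Sᶜ := by
  refine ⟨by rw [Finset.card_compl, hS.1]; rfl, fun c hc hsub => ?_⟩
  by_contra hne
  obtain ⟨i, hi⟩ := Finset.nonempty_iff_ne_empty.2 hne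
  have hiS : i ∉ S := Finset.mem_compl.1 (hsub hi)
  obtain ⟨r, hr, h⟩ := exists_row hC hS hiS
  have he := even_inter hC hc hr
  have e : c ∩ r = {i} := by
    ext x
    rw [Finset.mem_inter, Finset.mem_singleton]
    constructor
    · rintro ⟨h1, h2⟩
      exact (h x (Finset.mem_compl.1 (hsub h1))).1 h2
    · rintro rfl
      exact ⟨hi, (h x hiS).2 rfl⟩
  rw [e] at he
  simp at he

theorem card_split (ρ : Fin 12 ⊕ Fin 12 ≃ Fin 24) (s : Finset (Fin 24)) :
    s.card = (Finset.univ.filter fun i => ρ (Sum.inl i) ∈ s).card +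
      (Finset.univ.filter fun j => ρ (Sum.inr j) ∈ s).card := by
  have h1 : s.card = ∑ x : Fin 24, if x ∈ s then 1 else 0 := by
    rw [← Finset.card_filter, Finset.filter_univ_mem]
  rw [h1, ← Equiv.sum_comp ρ, Fintype.sum_sum_type, Finset.card_filter, Finset.card_filter]

/-- The matrix recording non-membership. -/
def mat (ρ : Fin 12 ⊕ Fin 12 ≃ Fin 24) (r : Fin 12 → Finset (Fin 24)) : Fin 12 → Fin 12 → Bool :=
  fun i j => !decide (ρ (Sum.inr j) ∈ r i)

theorem card_row (ρ : Fin 12 ⊕ Fin 12 ≃ Fin 24) (r : Fin 12 → Finset (Fin 24))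
    (hd : ∀ i i', ρ (Sum.inl i') ∈ r i ↔ i' = i) (i : Fin 12) :
    (r i).card + wt (mat ρ r i) = 13 := by
  have h := Finset.card_filter_add_card_filter_not (s := (Finset.univ : Finset (Fin 12)))
    (fun j => ρ (Sum.inr j) ∈ r i)
  have h1 : (Finset.univ.filter fun i' => ρ (Sum.inl i') ∈ r i).card = 1 :=
    Finset.card_eq_one.2 ⟨i, by ext; simp [hd]⟩
  have h2 : wt (mat ρ r i) = (Finset.univ.filter fun j => ¬ ρ (Sum.inr j) ∈ r i).card := by
    simp [wt, mat]
  rw [card_split ρ (r i), h1, h2]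
  simp only [Finset.card_univ, Fintype.card_fin] at h
  omega

theorem half_of (hC : IsGolayCode C) (ρ : Fin 12 ⊕ Fin 12 ≃ Fin 24) (r : Fin 12 → Finset (Fin 24))
    (hr : ∀ i, r i ∈ K C) (hd : ∀ i i', ρ (Sum.inl i') ∈ r i ↔ i' = i) : Half (mat ρ r) := by
  have hw : ∀ f : Fin 12 → Bool, wt f ≤ 12 := fun f => by
    have := Finset.card_filter_le (Finset.univ : Finset (Fin 12)) fun j => f j = true
    simpa [wt] using this
  refine ⟨fun i => ?_, fun i k hik => ?_⟩
  · have h1 := card_row ρ r hd i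
    have h2 := weights hC (hr i)
    have h3 := hw (mat ρ r i)
    omega
  · have h1 := weights hC (add_mem (hr i) (hr k))
    have h2 := card_split ρ (r i ∆ r k)
    have h3 : (Finset.univ.filter fun i' => ρ (Sum.inl i') ∈ r i ∆ r k).card = 2 := by
      rw [← Finset.card_pair hik]
      refine congrArg Finset.card ?_
      ext x
      simp only [Finset.mem_filter, Finset.mem_univ, true_and, Finset.mem_symmDiff, hd,
        Finset.mem_insert, Finset.mem_singleton]
      constructor
      · clear * -
        tauto
      · rintro (rfl | rfl)
        · exact Or.inl ⟨rfl, hik⟩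
        · exact Or.inr ⟨rfl, Ne.symm hik⟩
    have h4 : (Finset.univ.filter fun j => ρ (Sum.inr j) ∈ r i ∆ r k).card +
        2 * ix (mat ρ r i) (mat ρ r k) = wt (mat ρ r i) + wt (mat ρ r k) := by
      simp only [ix, wt, Finset.card_filter]
      rw [Finset.mul_sum, ← Finset.sum_add_distrib, ← Finset.sum_add_distrib]
      refine Finset.sum_congr rfl fun j _ => ?_
      by_cases a : ρ (Sum.inr j) ∈ r i <;> by_cases b : ρ (Sum.inr j) ∈ r k <;>
        simp [mat, Finset.mem_symmDiff, a, b]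
    have h5 := Finset.card_filter_le (Finset.univ : Finset (Fin 12))
      fun j => ρ (Sum.inr j) ∈ r i ∆ r k
    simp only [Finset.card_univ, Fintype.card_fin] at h5
    omega

theorem exists_rho {S : Finset (Fin 24)} (hS : S.card = 12) :
    ∃ ρ : Fin 12 ⊕ Fin 12 ≃ Fin 24, (∀ i, ρ (Sum.inl i) ∉ S) ∧ ∀ j, ρ (Sum.inr j) ∈ S := by
  have h1 : Fintype.card {x // x ∈ S} = Fintype.card (Fin 12) := by simp [hS]
  have h2 : Fintype.card {x // ¬ x ∈ S} = Fintype.card (Fin 12) := by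
    rw [Fintype.card_subtype_compl]; simp [hS]
  let e1 := (Fintype.equivOfCardEq h1).symm
  let e2 := (Fintype.equivOfCardEq h2).symm
  refine ⟨((Equiv.sumComm _ _).trans (Equiv.sumCongr e1 e2)).trans
    (Equiv.sumCompl fun x => x ∈ S), fun i => ?_, fun j => ?_⟩
  · simpa using (e2 i).2
  · simpa using (e1 j).2

theorem pen_iff {S : Finset (Fin 24)} (hS : Free C S) (ρ : Fin 12 ⊕ Fin 12 ≃ Fin 24)
    (hl : ∀ i, ρ (Sum.inl i) ∉ S) (hrS : ∀ j, ρ (Sum.inr j) ∈ S) (r : Fin 12 → Finset (Fin 24))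
    (hr : ∀ i, r i ∈ K C) (hd : ∀ i i', ρ (Sum.inl i') ∈ r i ↔ i' = i) :
    Pen C S ↔ ∃ i, wt (mat ρ r i) = 1 := by
  constructor
  · rintro ⟨-, D, hD, h11⟩
    obtain ⟨hDK, h12⟩ := mem_wd.1 hD
    have a := Finset.card_sdiff_add_card_inter D S
    obtain ⟨x, hx⟩ := Finset.card_eq_one.1 (show (D \ S).card = 1 by omega)
    have hx' : ∀ y, (y ∈ D ∧ y ∉ S) ↔ y = x := fun y => by
      rw [← Finset.mem_sdiff, hx, Finset.mem_singleton]
    obtain ⟨y, rfl⟩ := ρ.surjective x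
    rcases y with i | j
    · have e : D = r i := by
        refine row_unique hS hDK (hr i) fun z hz => ?_
        obtain ⟨w, rfl⟩ := ρ.surjective z
        rcases w with k | k
        · have := hx' (ρ (Sum.inl k))
          rw [hd]
          simp only [hz, not_false_eq_true, and_true, EmbeddingLike.apply_eq_iff_eq,
            Sum.inl.injEq] at this
          exact this
        · exact absurd (hrS k) hz
      have := card_row ρ r hd i
      rw [← e] at this
      exact ⟨i, by omega⟩
    · exact absurd (hrS j) ((hx' _).2 rfl).2
  · rintro ⟨i, hi⟩
    have h := card_row ρ r hd i
    have h12 : (r i).card = 12 := by omega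
    refine ⟨hS.1, r i, mem_wd.2 ⟨hr i, h12⟩, ?_⟩
    have h1 := card_split ρ (r i)
    have h2 := card_split ρ (r i ∩ S)
    have h3 : (Finset.univ.filter fun i' => ρ (Sum.inl i') ∈ r i).card = 1 :=
      Finset.card_eq_one.2 ⟨i, by ext; simp [hd]⟩
    simp only [Finset.mem_inter, hl, hrS, and_true, and_false, Finset.filter_false,
      Finset.card_empty] at h2
    omega

/-- `S` has the matrix `M` in suitable coordinates. -/
def Form (C : Submodule (ZMod 2) (Fin 24 → ZMod 2)) (S : Finset (Fin 24))
    (M : Fin 12 → Fin 12 → Bool) : Prop :=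
  ∃ ρ : Fin 12 ⊕ Fin 12 ≃ Fin 24, (∀ i, ρ (Sum.inl i) ∉ S) ∧ (∀ j, ρ (Sum.inr j) ∈ S) ∧
    ∃ r : Fin 12 → Finset (Fin 24), (∀ i, r i ∈ K C) ∧
      (∀ i i', ρ (Sum.inl i') ∈ r i ↔ i' = i) ∧ ∀ i j, mat ρ r i j = M i j

theorem form_perm {S : Finset (Fin 24)} {M N : Fin 12 → Fin 12 → Bool} (h : Form C S M)
    (σ τ : Equiv.Perm (Fin 12)) (hN : ∀ i j, M (σ i) (τ j) = N i j) : Form C S N := by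
  obtain ⟨ρ, hl, hr, r, hK, hd, hM⟩ := h
  refine ⟨(Equiv.sumCongr σ τ).trans ρ, fun i => ?_, fun j => ?_, fun i => r (σ i),
    fun i => hK _, fun i i' => ?_, fun i j => ?_⟩
  · simpa using hl (σ i)
  · simpa using hr (τ j)
  · simp [hd]
  · rw [← hN, ← hM]
    simp [mat]

theorem exists_form (hC : IsGolayCode C) {S : Finset (Fin 24)} (hS : Free C S) :
    ∃ B, Form C S B ∧ Half B ∧ (Half fun j i => B i j) ∧ (Pen C S ↔ ∃ i, wt (B i) = 1) := by
  obtain ⟨ρ, hl, hrS⟩ := exists_rho hS.1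
  have hS' := compl_free hC hS
  choose r hr hrd using fun i => exists_row hC hS (hl i)
  choose s hs hsd using fun j => exists_row hC hS' (i := ρ (Sum.inr j)) (by simpa using hrS j)
  have hd : ∀ i i', ρ (Sum.inl i') ∈ r i ↔ i' = i := by
    intro i i'
    rw [hrd i _ (hl i')]
    simp
  have hd' : ∀ j j', ρ (Sum.inr j') ∈ s j ↔ j' = j := by
    intro j j'
    rw [hsd j _ (by simpa using hrS j')]
    simp
  have hdual : ∀ i j, ρ (Sum.inr j) ∈ r i ↔ ρ (Sum.inl i) ∈ s j := by
    intro i j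
    have he := even_inter hC (hr i) (hs j)
    rw [card_split ρ] at he
    simp only [Finset.mem_inter, hd, hd', Finset.filter_and, Finset.filter_eq', Finset.mem_univ,
      if_true, Finset.singleton_inter, Finset.inter_singleton, Finset.mem_filter, true_and] at he
    by_cases a : ρ (Sum.inr j) ∈ r i <;> by_cases b : ρ (Sum.inl i) ∈ s j <;> simp [a, b] at he ⊢
  refine ⟨mat ρ r, ⟨ρ, hl, hrS, r, hr, hd, fun _ _ => rfl⟩, half_of hC ρ r hr hd, ?_,
    pen_iff hS ρ hl hrS r hr hd⟩
  have := half_of hC ((Equiv.sumComm _ _).trans ρ) s hs (by simpa using hd')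
  convert this using 3
  simp [mat, hdual]

theorem form_pen (hC : IsGolayCode C) {S : Finset (Fin 24)} (hS : Pen C S) :
    Form C S fun k j => (T1.getD k 0).testBit j := by
  obtain ⟨B, hF, hr, hc, hp⟩ := exists_form hC (hS.free hC)
  obtain ⟨i, hi⟩ := hp.1 hS
  obtain ⟨σ, τ, h⟩ := class1 B hr hc i hi
  exact form_perm hF σ τ h

theorem form_trans (hC : IsGolayCode C) {S : Finset (Fin 24)} (hS : Free C S) (hn : ¬ Pen C S) :
    Form C S fun k j => (T2.getD k 0).testBit j := by
  obtain ⟨B, hF, hr, hc, hp⟩ := exists_form hC hS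
  rw [hp, not_exists] at hn
  obtain ⟨σ, τ, h⟩ := class2 B hr hc fun i => (hr.w i).resolve_right (hn i)
  exact form_perm hF σ τ h

theorem image_mem_K {S : Finset (Fin 24)} (hS : Free C S) {ρ ρ' : Fin 12 ⊕ Fin 12 ≃ Fin 24}
    {r r' : Fin 12 → Finset (Fin 24)} (hrS : ∀ j, ρ (Sum.inr j) ∈ S) (hK : ∀ i, r i ∈ K C)
    (hK' : ∀ i, r' i ∈ K C) (hd : ∀ i i', ρ (Sum.inl i') ∈ r i ↔ i' = i)
    (hd' : ∀ i i', ρ' (Sum.inl i') ∈ r' i ↔ i' = i) (hm : ∀ i j, mat ρ r i j = mat ρ' r' i j)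
    (n : ℕ) : ∀ s ∈ K C, (Finset.univ.filter fun i => ρ (Sum.inl i) ∈ s).card = n →
      s.image (ρ.symm.trans ρ') ∈ K C := by
  have hrow : ∀ i, (r i).image (ρ.symm.trans ρ') = r' i := by
    intro i
    ext x
    obtain ⟨y, rfl⟩ := ρ'.surjective x
    have : ρ' y ∈ (r i).image (ρ.symm.trans ρ') ↔ ρ y ∈ r i := by
      rw [Finset.mem_image]
      constructor
      · rintro ⟨z, hz, h⟩
        have h2 : ρ' (ρ.symm z) = ρ' y := h
        rw [← ρ'.injective h2]
        simpa using hz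
      · intro h
        exact ⟨ρ y, h, by simp⟩
    rw [this]
    rcases y with k | k
    · rw [hd, hd']
    · have := hm i k
      simpa [mat] using this
  induction n with
  | zero =>
    intro s hs h0
    rw [Finset.card_eq_zero, Finset.filter_eq_empty_iff] at h0
    have : s = ∅ := by
      refine hS.2 s hs fun x hx => ?_
      obtain ⟨y, rfl⟩ := ρ.surjective x
      rcases y with k | k
      · exact absurd hx (h0 (Finset.mem_univ k))
      · exact hrS k
    rw [this, Finset.image_empty]
    exact empty_mem
  | succ n ih =>
    intro s hs hn
    obtain ⟨i, hi⟩ := Finset.card_pos.1 (show 0 < (Finset.univ.filter fun i => ρ (Sum.inl i) ∈ s).card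
      by omega)
    have hi' := (Finset.mem_filter.1 hi).2
    have e : (Finset.univ.filter fun k => ρ (Sum.inl k) ∈ s ∆ r i) =
        (Finset.univ.filter fun i => ρ (Sum.inl i) ∈ s).erase i := by
      ext k
      simp only [Finset.mem_filter, Finset.mem_univ, true_and, Finset.mem_symmDiff, hd,
        Finset.mem_erase]
      constructor
      · rintro (h | ⟨rfl, h⟩)
        · exact ⟨h.2, h.1⟩
        · exact absurd hi' h
      · rintro ⟨h1, h2⟩
        exact Or.inl ⟨h2, h1⟩
    have h := ih (s ∆ r i) (add_mem hs (hK i)) (by rw [e, Finset.card_erase_of_mem hi, hn]; rfl)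
    rw [Finset.image_symmDiff _ _ (Equiv.injective _), hrow] at h
    have h' := add_mem h (hK' i)
    rwa [symmDiff_symmDiff_cancel_right] at h'

theorem ind_comp (g : Equiv.Perm (Fin 24)) (s : Finset (Fin 24)) :
    ind (s.image g.symm) = fun i => ind s (g i) := by
  funext i
  have : i ∈ s.image g.symm ↔ g i ∈ s := by
    rw [Finset.mem_image]
    constructor
    · rintro ⟨z, hz, rfl⟩
      simpa using hz
    · intro h
      exact ⟨g i, h, by simp⟩
  simp only [ind, this]

theorem inM24_iff (g : Equiv.Perm (Fin 24)) : InM24 C g ↔ ∀ s ∈ K C, s.image g.symm ∈ K C := by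
  constructor
  · intro h s hs
    rw [mem_K, ind_comp]
    exact h _ (mem_K.1 hs)
  · intro h c hc
    have := h (Finset.univ.filter fun i => c i ≠ 0) (by rw [mem_K, ind_filter]; exact hc)
    rwa [mem_K, ind_comp, ind_filter] at this

theorem image_symm_image (g : Equiv.Perm (Fin 24)) (s : Finset (Fin 24)) :
    (s.image g).image g.symm = s := by
  rw [Finset.image_image]; simp

theorem image_image_symm (g : Equiv.Perm (Fin 24)) (s : Finset (Fin 24)) :
    (s.image g.symm).image g = s := by
  rw [Finset.image_image]; simp

theorem inM24_symm {g : Equiv.Perm (Fin 24)} (h : InM24 C g) : InM24 C g.symm := by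
  rw [inM24_iff] at h ⊢
  intro s hs
  have hsub : (K C).image (fun t : Finset (Fin 24) => t.image g.symm) ⊆ K C := by
    intro t ht
    obtain ⟨u, hu, rfl⟩ := Finset.mem_image.1 ht
    exact h u hu
  have heq := Finset.eq_of_subset_of_card_le hsub (by
    rw [Finset.card_image_of_injective]
    exact Finset.image_injective g.symm.injective)
  rw [← heq] at hs
  obtain ⟨t, ht, rfl⟩ := Finset.mem_image.1 hs
  rw [Equiv.symm_symm, image_image_symm]
  exact ht

theorem equiv_symm {S S' : Finset (Fin 24)} (h : M24Equiv C S S') : M24Equiv C S' S := by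
  obtain ⟨g, hg, rfl⟩ := h
  exact ⟨g.symm, inM24_symm hg, image_symm_image g S⟩

theorem equiv_free {S S' : Finset (Fin 24)} (h : M24Equiv C S S') (hS : Free C S) : Free C S' := by
  obtain ⟨g, hg, rfl⟩ := h
  refine ⟨by rw [Finset.card_image_of_injective _ g.injective, hS.1], fun c hc hsub => ?_⟩
  have := hS.2 _ ((inM24_iff g).1 hg c hc) (by
    rw [← image_symm_image g S]
    exact Finset.image_subset_image hsub)
  exact Finset.image_eq_empty.1 this

theorem equiv_pen {S S' : Finset (Fin 24)} (h : M24Equiv C S S') (hS : Pen C S) : Pen C S' := by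
  obtain ⟨g, hg, rfl⟩ := h
  obtain ⟨h12, D, hD, h11⟩ := hS
  obtain ⟨hK, hc⟩ := mem_wd.1 hD
  have hg' := (inM24_iff _).1 (inM24_symm hg) D hK
  rw [Equiv.symm_symm] at hg'
  refine ⟨by rw [Finset.card_image_of_injective _ g.injective, h12], D.image g, mem_wd.2 ⟨hg', ?_⟩, ?_⟩
  · rw [Finset.card_image_of_injective _ g.injective, hc]
  · rw [← Finset.image_inter _ _ g.injective, Finset.card_image_of_injective _ g.injective, h11]

theorem form_equiv {S S' : Finset (Fin 24)} (hS : Free C S) (hS' : Free C S')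
    {M : Fin 12 → Fin 12 → Bool} (h : Form C S M) (h' : Form C S' M) : M24Equiv C S S' := by
  obtain ⟨ρ, hl, hr, r, hK, hd, hM⟩ := h
  obtain ⟨ρ', hl', hr', r', hK', hd', hM'⟩ := h'
  refine ⟨ρ.symm.trans ρ', ?_, ?_⟩
  · rw [inM24_iff]
    intro s hs
    exact image_mem_K hS' hr' hK' hK hd' hd (fun i j => by rw [hM, hM']) _ s hs rfl
  · refine Finset.eq_of_subset_of_card_le ?_ ?_
    · intro x hx
      obtain ⟨z, hz, rfl⟩ := Finset.mem_image.1 hx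
      obtain ⟨y, rfl⟩ := ρ.surjective z
      rcases y with k | k
      · exact absurd hz (hl k)
      · simpa using hr' k
    · rw [Finset.card_image_of_injective _ (Equiv.injective _), hS.1, hS'.1]

theorem natCard_eq {P : Finset (Fin 24) → Prop} {Q : Finset (Fin 24) → Prop} [DecidablePred Q] (n : ℕ)
    (h : ∀ S, P S ↔ Q S) (h12 : ∀ S, Q S → S.card = 12) (hc : ((W 12).filter Q).card = n) :
    Nat.card {S // P S} = n := by
  rw [Nat.card_eq_fintype_card, Fintype.card_subtype, ← hc]
  refine congrArg Finset.card ?_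
  ext S
  rw [Finset.mem_filter, Finset.mem_filter, mem_W, h]
  exact ⟨fun x => ⟨h12 S x.2, x.2⟩, fun x => ⟨Finset.mem_univ _, x.2⟩⟩

theorem ex_trans (hC : IsGolayCode C) : ∃ S, Free C S ∧ ¬ Pen C S := by
  obtain ⟨S, h⟩ := Finset.card_pos.1 (lt_of_lt_of_eq (by norm_num) (card_trans hC).symm)
  exact ⟨S, (Finset.mem_filter.1 h).2⟩

theorem ex_pen (hC : IsGolayCode C) : ∃ S, Pen C S := by
  obtain ⟨S, h⟩ := Finset.card_pos.1 (lt_of_lt_of_eq (by norm_num) (card_pen hC).symm)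
  exact ⟨S, (Finset.mem_filter.1 h).2⟩

theorem natCard_trans (hC : IsGolayCode C) {P : Finset (Fin 24) → Prop}
    (h : ∀ S, P S ↔ Free C S ∧ ¬ Pen C S) : Nat.card {S // P S} = 1020096 :=
  natCard_eq _ h (fun _ h => h.1.1) (card_trans hC)

theorem natCard_pen (hC : IsGolayCode C) {P : Finset (Fin 24) → Prop}
    (h : ∀ S, P S ↔ Pen C S) : Nat.card {S // P S} = 370944 :=
  natCard_eq _ h (fun _ h => h.1) (card_pen hC)

end GolayAux

/-- Under `M₂₄` there are exactly two orbits of 12-element subsets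
containing no nonzero Golay codeword (the transverse and penumbral dodecads), of
sizes `2⁶·3²·7·11·23 = 1020096` and `2⁸·3²·7·23 = 370944`. -/
theorem two_orbits_of_free_dodecads (C : Submodule (ZMod 2) (Fin 24 → ZMod 2))
    (hC : IsGolayCode C) :
    ∃ S₁ S₂ : Finset (Fin 24), IsFreeDodecad C S₁ ∧ IsFreeDodecad C S₂ ∧
      ¬ M24Equiv C S₁ S₂ ∧
      (∀ S, IsFreeDodecad C S → M24Equiv C S₁ S ∨ M24Equiv C S₂ S) ∧
      Nat.card {S : Finset (Fin 24) // M24Equiv C S₁ S} = 2^6 * 3^2 * 7 * 11 * 23 ∧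
      Nat.card {S : Finset (Fin 24) // M24Equiv C S₂ S} = 2^8 * 3^2 * 7 * 23 := by
  obtain ⟨S₁, f1, n1⟩ := GolayAux.ex_trans hC
  obtain ⟨S₂, p2⟩ := GolayAux.ex_pen hC
  have f2 := p2.free hC
  have k1 : ∀ S, M24Equiv C S₁ S ↔ GolayAux.Free C S ∧ ¬ GolayAux.Pen C S := by
    intro S
    constructor
    · intro h
      exact ⟨GolayAux.equiv_free h f1, fun hp => n1 (GolayAux.equiv_pen (GolayAux.equiv_symm h) hp)⟩
    · rintro ⟨hf, hn⟩
      exact GolayAux.form_equiv f1 hf (GolayAux.form_trans hC f1 n1) (GolayAux.form_trans hC hf hn)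
  have k2 : ∀ S, M24Equiv C S₂ S ↔ GolayAux.Pen C S := by
    intro S
    constructor
    · intro h
      exact GolayAux.equiv_pen h p2
    · intro hp
      exact GolayAux.form_equiv f2 (hp.free hC) (GolayAux.form_pen hC p2) (GolayAux.form_pen hC hp)
  refine ⟨S₁, S₂, (GolayAux.free_iff S₁).2 f1, (GolayAux.free_iff S₂).2 f2, ?_, ?_, ?_, ?_⟩
  · intro h
    exact ((k1 S₂).1 h).2 p2
  · intro S hS
    rw [GolayAux.free_iff] at hS
    by_cases hp : GolayAux.Pen C S
    · exact Or.inr ((k2 S).2 hp)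
    · exact Or.inl ((k1 S).2 ⟨hS, hp⟩)
  · rw [GolayAux.natCard_trans hC k1]; norm_num
  · rw [GolayAux.natCard_pen hC k2]; norm_num
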